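/- Let k ≥ m ≥ 1, let Q belong to the unital subalgebra of End(V^{⊗m}) generated by R₁, …, R_{m−1}, and let Z belong to the unital subalgebra of End(V^{⊗k}) generated by R₁, …, R_{k−1}. Then there exists Z̃ in the unital subalgebra of End(V^{⊗(k−m)}) generated by R₁, …, R_{k−m−1} (a scalar when k = m) such that Tr_{R(1…m)}(Q · D_{⟨1→m⟩}) · Tr_{R(1…k)}(Z · M_{⟨1→k⟩}) − Tr_{R(1…(k−m))}(Z̃ · M_{⟨1→(k−m)⟩}) belongs to the left ideal of A generated by the entries of D; if k < m, then the product Tr_{R(1…m)}(Q · D_{⟨1→m⟩}) · Tr_{R(1…k)}(Z · M_{⟨1→k⟩}) itself belongs to that left ideal. (Equivalently: every generalized quantum Laplace operator maps the characteristic subalgebra of the reflection-equation algebra into itself.) -/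

import Mathlib

open scoped BigOperators

noncomputable section

/-- One-site embedding of an `N×N` matrix into `Mat_{N^k}` at 0-based position `i`
(the paper's `X_{i+1}` in 1-based numbering).  Out of range we return the identity. -/
def matAt {α : Type*} [Semiring α] (N k : ℕ) (X : Matrix (Fin N) (Fin N) α) (i : ℕ) :
    Matrix (Fin k → Fin N) (Fin k → Fin N) α :=
  if h : i < k then
    Matrix.of fun a b =>
      if ∀ l : Fin k, (l : ℕ) ≠ i → a l = b l then X (a ⟨i, h⟩) (b ⟨i, h⟩) else 0
  else 1

/-- Two-site embedding of an operator on `V⊗V` into `Mat_{N^k}` at 0-based positions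
`i, i+1` (the paper's `R_{i+1}` in 1-based numbering). -/
def opAt {α : Type*} [Semiring α] (N k : ℕ)
    (R : Matrix (Fin N × Fin N) (Fin N × Fin N) α) (i : ℕ) :
    Matrix (Fin k → Fin N) (Fin k → Fin N) α :=
  if h : i + 1 < k then
    Matrix.of fun a b =>
      if ∀ l : Fin k, (l : ℕ) ≠ i → (l : ℕ) ≠ i + 1 → a l = b l then
        R (a ⟨i, by omega⟩, a ⟨i + 1, h⟩) (b ⟨i, by omega⟩, b ⟨i + 1, h⟩)
      else 0
  else 1

/-- A numeric (complex) matrix viewed inside `Mat(A)` via the unit of `A`. -/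
def toA (A : Type*) [Semiring A] [Algebra ℂ A] {ι : Type*} (X : Matrix ι ι ℂ) :
    Matrix ι ι A :=
  X.map (algebraMap ℂ A)

/-- The braid relation `R₁R₂R₁ = R₂R₁R₂` on `V^{⊗3}`. -/
def IsBraid (N : ℕ) (R : Matrix (Fin N × Fin N) (Fin N × Fin N) ℂ) : Prop :=
  opAt N 3 R 0 * opAt N 3 R 1 * opAt N 3 R 0 = opAt N 3 R 1 * opAt N 3 R 0 * opAt N 3 R 1

/-- The Hecke condition `(q·I − R)(q⁻¹·I + R) = 0`. -/
def IsHecke (N : ℕ) (q : ℂ) (R : Matrix (Fin N × Fin N) (Fin N × Fin N) ℂ) : Prop :=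
  (q • (1 : Matrix (Fin N × Fin N) (Fin N × Fin N) ℂ) - R) * (q⁻¹ • 1 + R) = 0

/-- `q` is generic: `q ∉ {0, 1, −1}` and `qⁿ ≠ 1` for all positive integers `n`. -/
def GenericQ (q : ℂ) : Prop :=
  q ≠ 0 ∧ q ≠ 1 ∧ q ≠ -1 ∧ ∀ n : ℕ, 0 < n → q ^ n ≠ 1

/-- The reflection-equation type relation `R X₁ R X₁ = X₁ R X₁ R` in `Mat_{N²}`. -/
def RErel {α : Type*} [Semiring α] (N : ℕ)
    (R : Matrix (Fin N × Fin N) (Fin N × Fin N) α) (X : Matrix (Fin N) (Fin N) α) : Prop :=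
  opAt N 2 R 0 * matAt N 2 X 0 * opAt N 2 R 0 * matAt N 2 X 0 =
    matAt N 2 X 0 * opAt N 2 R 0 * matAt N 2 X 0 * opAt N 2 R 0

/-- The quantum-double permutation relation `D₁ R M₁ R = R M₁ R⁻¹ D₁ + R` in `Mat_{N²}(A)`. -/
def PermRel {A : Type*} [Ring A] [Algebra ℂ A] (N : ℕ)
    (R Rinv : Matrix (Fin N × Fin N) (Fin N × Fin N) ℂ)
    (M D : Matrix (Fin N) (Fin N) A) : Prop :=
  matAt N 2 D 0 * opAt N 2 (toA A R) 0 * matAt N 2 M 0 * opAt N 2 (toA A R) 0 =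
    opAt N 2 (toA A R) 0 * matAt N 2 M 0 * opAt N 2 (toA A Rinv) 0 * matAt N 2 D 0 +
      opAt N 2 (toA A R) 0

/-- The homogeneous permutation relation `D₁ R M₁ R = R M₁ R⁻¹ D₁` in `Mat_{N²}(A)`. -/
def PermRelHom {A : Type*} [Ring A] [Algebra ℂ A] (N : ℕ)
    (R Rinv : Matrix (Fin N × Fin N) (Fin N × Fin N) ℂ)
    (M D : Matrix (Fin N) (Fin N) A) : Prop :=
  matAt N 2 D 0 * opAt N 2 (toA A R) 0 * matAt N 2 M 0 * opAt N 2 (toA A R) 0 =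
    opAt N 2 (toA A R) 0 * matAt N 2 M 0 * opAt N 2 (toA A Rinv) 0 * matAt N 2 D 0

/-- Overline copies: `ovCopy … r = X_{⟨r+1⟩}`, i.e. `X_{⟨1⟩} = X⊗I⊗⋯⊗I` and
`X_{⟨r+1⟩} = R_r X_{⟨r⟩} R_r⁻¹`. -/
def ovCopy {α : Type*} [Semiring α] (N k : ℕ)
    (R Rinv : Matrix (Fin N × Fin N) (Fin N × Fin N) α)
    (X : Matrix (Fin N) (Fin N) α) : ℕ → Matrix (Fin k → Fin N) (Fin k → Fin N) α
  | 0 => matAt N k X 0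
  | r + 1 => opAt N k R r * ovCopy N k R Rinv X r * opAt N k Rinv r

/-- Underline copies: `unCopy … r = X_{[r+1]}`, i.e. `X_{[1]} = X⊗I⊗⋯⊗I` and
`X_{[r+1]} = R_r⁻¹ X_{[r]} R_r`. -/
def unCopy {α : Type*} [Semiring α] (N k : ℕ)
    (R Rinv : Matrix (Fin N × Fin N) (Fin N × Fin N) α)
    (X : Matrix (Fin N) (Fin N) α) : ℕ → Matrix (Fin k → Fin N) (Fin k → Fin N) α
  | 0 => matAt N k X 0
  | r + 1 => opAt N k Rinv r * unCopy N k R Rinv X r * opAt N k R r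

/-- `X_{⟨1→n⟩} = X_{⟨1⟩}X_{⟨2⟩}⋯X_{⟨n⟩}`. -/
def ovProd {α : Type*} [Semiring α] (N k : ℕ)
    (R Rinv : Matrix (Fin N × Fin N) (Fin N × Fin N) α)
    (X : Matrix (Fin N) (Fin N) α) (n : ℕ) : Matrix (Fin k → Fin N) (Fin k → Fin N) α :=
  ((List.range n).map (ovCopy N k R Rinv X)).prod

/-- `X_{⟨n→1⟩} = X_{⟨n⟩}X_{⟨n−1⟩}⋯X_{⟨1⟩}`. -/
def ovProdRev {α : Type*} [Semiring α] (N k : ℕ)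
    (R Rinv : Matrix (Fin N × Fin N) (Fin N × Fin N) α)
    (X : Matrix (Fin N) (Fin N) α) (n : ℕ) : Matrix (Fin k → Fin N) (Fin k → Fin N) α :=
  ((List.range n).reverse.map (ovCopy N k R Rinv X)).prod

/-- Shifted Jucys–Murphy matrices: `JMup … R n s = J_{s+1}^{↑n}`, i.e. `J₁^{↑n} = I` and
`J_{s+1}^{↑n} = R_{n+s} J_s^{↑n} R_{n+s}` (paper's 1-based `R_{n+s}` is `opAt … (n+s-1)`).
Applying it to `R⁻¹` produces `(J_{s+1}^{↑n})⁻¹`. -/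
def JMup {α : Type*} [Semiring α] (N k : ℕ)
    (R : Matrix (Fin N × Fin N) (Fin N × Fin N) α) (n : ℕ) :
    ℕ → Matrix (Fin k → Fin N) (Fin k → Fin N) α
  | 0 => 1
  | s + 1 => opAt N k R (n + s) * JMup N k R n s * opAt N k R (n + s)

/-- The quantum trace `Tr_{R(1…n)}(X) = Tr(C₁C₂⋯C_n X)`. -/
def qTr {α : Type*} [Semiring α] (N n : ℕ) (C : Matrix (Fin N) (Fin N) α)
    (X : Matrix (Fin n → Fin N) (Fin n → Fin N) α) : α :=
  Matrix.trace (((List.range n).map (matAt N n C)).prod * X)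

/-- The matrix `C`, `C_i^j = Σ_k Ψ_{ik}^{jk}`. -/
def traceMat (N : ℕ) (Ψ : Matrix (Fin N × Fin N) (Fin N × Fin N) ℂ) :
    Matrix (Fin N) (Fin N) ℂ :=
  Matrix.of fun i j => ∑ k, Ψ (i, k) (j, k)

/-- Skew-invertibility of `R`: `Tr₂(R₁₂Ψ₂₃) = Tr₂(Ψ₁₂R₂₃) = P₁₃`, written componentwise. -/
def SkewInv (N : ℕ) (R Ψ : Matrix (Fin N × Fin N) (Fin N × Fin N) ℂ) : Prop :=
  (∀ i k l n : Fin N, ∑ j, ∑ b, R (i, j) (l, b) * Ψ (b, k) (j, n) =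
      if i = n ∧ k = l then 1 else 0) ∧
  (∀ i k l n : Fin N, ∑ j, ∑ b, Ψ (i, j) (l, b) * R (b, k) (j, n) =
      if i = n ∧ k = l then 1 else 0)

/-- The generators `R₁, …, R_{n−1}` (1-based) of the Hecke-algebra image inside
`End(V^{⊗k})`, as a subset of `Mat_{N^k}`. -/
def genSet {α : Type*} [Semiring α] (N k n : ℕ)
    (R : Matrix (Fin N × Fin N) (Fin N × Fin N) α) :
    Set (Matrix (Fin k → Fin N) (Fin k → Fin N) α) :=
  {X | ∃ i : ℕ, i + 1 < n ∧ X = opAt N k R i}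

/-- The left ideal of `A` generated by the entries of `D`. -/
def entryIdeal (A : Type*) [Ring A] {N : ℕ} (D : Matrix (Fin N) (Fin N) A) :
    Submodule A A :=
  Submodule.span A {x : A | ∃ i j : Fin N, x = D i j}

/-- The normally ordered monomial `:L̂_{⟨1→k⟩}: = M_{⟨1→k⟩} D_{⟨k→1⟩} ∏_{s=1}^{k} J_s⁻¹`. -/
def normOrd {α : Type*} [Semiring α] (N k : ℕ)
    (R Rinv : Matrix (Fin N × Fin N) (Fin N × Fin N) α)
    (M D : Matrix (Fin N) (Fin N) α) (n : ℕ) :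
    Matrix (Fin k → Fin N) (Fin k → Fin N) α :=
  ovProd N k R Rinv M n * ovProdRev N k R Rinv D n *
    ((List.range n).map (fun s => JMup N k Rinv 0 s)).prod

set_option linter.unusedSectionVars false

section MatUnits

variable {ι κ B : Type*} [Fintype ι] [DecidableEq ι] [Fintype κ] [DecidableEq κ]
  [Ring B] [Algebra ℂ B]

/-- A system of matrix units in a ring. -/
structure MatUnits (u : ι → ι → B) : Prop where
  mul : ∀ a b c d, u a b * u c d = if b = c then u a d else 0
  sum : ∑ a, u a a = 1

/-- The image of a numeric matrix under a system of matrix units. -/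
def matRep (u : ι → ι → B) (X : Matrix ι ι ℂ) : B := ∑ x, ∑ y, X x y • u x y

/-- The trace weighted by `C` over the site carrying the matrix units `u`, with the identity left
at that site. -/
def siteTr (C : Matrix ι ι ℂ) (u : ι → ι → B) (x : B) : B :=
  ∑ a, ∑ b, ∑ w, C a b • (u w b * x * u a w)

/-- Products of two systems of matrix units. -/
def prodUnits (f : ι → ι → B) (g : κ → κ → B) : ι × κ → ι × κ → B :=
  fun x y => f x.1 y.1 * g x.2 y.2

/-- The partial trace of a numeric matrix over the second factor, weighted by `C`. -/
def ptrace (C : Matrix κ κ ℂ) (X : Matrix (ι × κ) (ι × κ) ℂ) : Matrix ι ι ℂ :=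
  Matrix.of fun a c => ∑ b, ∑ d, X (a, b) (c, d) * C d b

theorem MatUnits.matRep_mul {u : ι → ι → B} (hu : MatUnits u) (X Y : Matrix ι ι ℂ) :
    matRep u (X * Y) = matRep u X * matRep u Y := by
  simp only [matRep, Finset.sum_mul, Finset.mul_sum, smul_mul_smul_comm, hu.mul, smul_ite,
    smul_zero, Matrix.mul_apply, Finset.sum_smul]
  simp only [Finset.sum_ite_eq', Finset.mem_univ, if_true]
  calc _ = ∑ a, ∑ c, ∑ d, (X a c * Y c d) • u a d :=
        Finset.sum_congr rfl fun a _ => Finset.sum_comm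
    _ = ∑ c, ∑ a, ∑ d, (X a c * Y c d) • u a d := Finset.sum_comm
    _ = ∑ c, ∑ d, ∑ a, (X a c * Y c d) • u a d :=
        Finset.sum_congr rfl fun c _ => Finset.sum_comm
    _ = _ := by simp

theorem MatUnits.matRep_one {u : ι → ι → B} (hu : MatUnits u) : matRep u 1 = 1 := by
  simp [matRep, Matrix.one_apply, hu.sum]

theorem matRep_add (u : ι → ι → B) (X Y : Matrix ι ι ℂ) :
    matRep u (X + Y) = matRep u X + matRep u Y := by
  simp [matRep, add_smul, Finset.sum_add_distrib]

theorem matRep_smul (u : ι → ι → B) (c : ℂ) (X : Matrix ι ι ℂ) :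
    matRep u (c • X) = c • matRep u X := by
  simp [matRep, Finset.smul_sum, mul_smul]

theorem MatUnits.matRep_coeff {u : ι → ι → B} (hu : MatUnits u) (X : Matrix ι ι ℂ) (a b : ι) :
    ∑ w, u w a * matRep u X * u b w = X a b • 1 := by
  simp only [matRep, Finset.sum_mul, Finset.mul_sum, smul_mul_assoc, mul_smul_comm, hu.mul,
    ite_mul, zero_mul, smul_ite, smul_zero, ← hu.sum, Finset.smul_sum]
  simp

theorem MatUnits.matRep_injective [Nontrivial B] {u : ι → ι → B} (hu : MatUnits u) :
    Function.Injective (matRep u) := by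
  intro X Y h
  ext a b
  have h1 := hu.matRep_coeff X a b
  rw [h, hu.matRep_coeff] at h1
  exact (smul_left_injective ℂ (one_ne_zero (α := B)) h1).symm

theorem siteTr_add (C : Matrix ι ι ℂ) (u : ι → ι → B) (x y : B) :
    siteTr C u (x + y) = siteTr C u x + siteTr C u y := by
  simp [siteTr, mul_add, add_mul, Finset.sum_add_distrib]

theorem siteTr_smul (C : Matrix ι ι ℂ) (u : ι → ι → B) (c : ℂ) (x : B) :
    siteTr C u (c • x) = c • siteTr C u x := by
  simp only [siteTr, mul_smul_comm, smul_mul_assoc, Finset.smul_sum, smul_comm c]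

theorem siteTr_sum {σ : Type*} (s : Finset σ) (C : Matrix ι ι ℂ) (u : ι → ι → B) (x : σ → B) :
    siteTr C u (∑ i ∈ s, x i) = ∑ i ∈ s, siteTr C u (x i) := by
  classical
  induction s using Finset.induction_on with
  | empty => simp [siteTr]
  | insert i s hi ih => rw [Finset.sum_insert hi, Finset.sum_insert hi, siteTr_add, ih]

theorem siteTr_mul_left (C : Matrix ι ι ℂ) {u : ι → ι → B} {x : B}
    (hx : ∀ a b, u a b * x = x * u a b) (y : B) : siteTr C u (x * y) = x * siteTr C u y := by
  simp only [siteTr, Finset.mul_sum, mul_smul_comm]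
  simp only [← mul_assoc, hx]

theorem siteTr_mul_right (C : Matrix ι ι ℂ) {u : ι → ι → B} {x : B}
    (hx : ∀ a b, u a b * x = x * u a b) (y : B) : siteTr C u (y * x) = siteTr C u y * x := by
  simp only [siteTr, Finset.sum_mul, smul_mul_assoc]
  simp only [mul_assoc, hx]

theorem MatUnits.siteTr_unit {u : ι → ι → B} (hu : MatUnits u) (C : Matrix ι ι ℂ) (a b : ι) :
    siteTr C u (u a b) = C b a • 1 := by
  simp only [siteTr, hu.mul, ite_mul, zero_mul, smul_ite, smul_zero, ← hu.sum, Finset.smul_sum]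
  rw [Finset.sum_eq_single b, Finset.sum_eq_single a] <;> simp +contextual [eq_comm]

theorem MatUnits.siteTr_one {u : ι → ι → B} (hu : MatUnits u) (C : Matrix ι ι ℂ) :
    siteTr C u 1 = C.trace • 1 := by
  rw [← hu.sum, siteTr_sum]
  simp only [hu.siteTr_unit, ← Finset.sum_smul, Matrix.trace, Matrix.diag, hu.sum]

theorem MatUnits.unit_mul_siteTr {u : ι → ι → B} (hu : MatUnits u) (C : Matrix ι ι ℂ) (x : B)
    (a b : ι) : u a b * siteTr C u x = siteTr C u x * u a b := by
  simp only [siteTr, Finset.mul_sum, Finset.sum_mul, mul_smul_comm, smul_mul_assoc]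
  refine Finset.sum_congr rfl fun c _ => Finset.sum_congr rfl fun d _ => ?_
  simp only [mul_assoc, hu.mul]
  simp only [← mul_assoc, hu.mul]
  simp

theorem MatUnits.prod {f : ι → ι → B} {g : κ → κ → B} (hf : MatUnits f) (hg : MatUnits g)
    (hfg : ∀ a b c d, f a b * g c d = g c d * f a b) : MatUnits (prodUnits f g) where
  mul a b c d := by
    have : f a.1 b.1 * g a.2 b.2 * (f c.1 d.1 * g c.2 d.2) =
        (f a.1 b.1 * f c.1 d.1) * (g a.2 b.2 * g c.2 d.2) := by
      rw [mul_assoc, mul_assoc, ← mul_assoc (g _ _), ← hfg, mul_assoc]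
    simp only [prodUnits, this, hf.mul, hg.mul, Prod.ext_iff]
    split_ifs <;> simp_all
  sum := by
    simp only [prodUnits, Fintype.sum_prod_type, ← Finset.mul_sum, hg.sum, mul_one, hf.sum]

theorem siteTr_siteTr {f : ι → ι → B} {g : κ → κ → B}
    (hfg : ∀ a b c d, f a b * g c d = g c d * f a b) (C : Matrix ι ι ℂ) (C' : Matrix κ κ ℂ)
    (x : B) : siteTr C f (siteTr C' g x) =
      siteTr (Matrix.kroneckerMap (· * ·) C C') (prodUnits f g) x := by
  have key : ∀ a b w c d v, f w b * (g v d * x * g c v) * f a w =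
      f w b * g v d * x * (f a w * g c v) := by
    intros a b w c d v
    rw [hfg a w]; simp only [mul_assoc]
  simp only [siteTr, prodUnits, Fintype.sum_prod_type, Finset.mul_sum, Finset.sum_mul,
    mul_smul_comm, smul_mul_assoc, key, Finset.smul_sum, smul_smul, Matrix.kroneckerMap_apply]
  refine Finset.sum_congr rfl fun a _ => ?_
  calc _ = ∑ b, ∑ c, ∑ w, ∑ d, ∑ v,
        (C a b * C' c d) • (f w b * g v d * x * (f a w * g c v)) :=
        Finset.sum_congr rfl fun b _ => Finset.sum_comm
    _ = ∑ c, ∑ b, ∑ w, ∑ d, ∑ v,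
        (C a b * C' c d) • (f w b * g v d * x * (f a w * g c v)) := Finset.sum_comm
    _ = _ := Finset.sum_congr rfl fun c _ => Finset.sum_congr rfl fun b _ => Finset.sum_comm

theorem MatUnits.siteTr_eq {u : ι → ι → B} (hu : MatUnits u) (C : Matrix ι ι ℂ) (x : B) :
    siteTr C u x = ∑ w, ∑ v, u w v * (x * matRep u C) * u v w := by
  simp only [matRep, Finset.mul_sum, Finset.sum_mul, mul_smul_comm, smul_mul_assoc]
  simp only [mul_assoc, hu.mul, mul_ite, mul_zero, smul_ite, smul_zero]
  simp only [siteTr, mul_assoc]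
  calc _ = ∑ b, ∑ a, ∑ w, C a b • (u w b * (x * u a w)) := Finset.sum_comm
    _ = ∑ b, ∑ w, ∑ a, C a b • (u w b * (x * u a w)) :=
        Finset.sum_congr rfl fun b _ => Finset.sum_comm
    _ = ∑ w, ∑ b, ∑ a, C a b • (u w b * (x * u a w)) := Finset.sum_comm
    _ = _ := by simp

theorem MatUnits.sum_unit_comm {u : ι → ι → B} (hu : MatUnits u) (X : Matrix ι ι ℂ) (y : B) :
    ∑ w, ∑ v, u w v * (matRep u X * y) * u v w = ∑ w, ∑ v, u w v * (y * matRep u X) * u v w := by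
  have h1 : ∀ a b, ∑ w, ∑ v, u w v * (u a b * y) * u v w =
      ∑ w, ∑ v, u w v * (y * u a b) * u v w := by
    intro a b
    refine Finset.sum_congr rfl fun w _ => ?_
    simp only [mul_assoc, hu.mul]
    simp only [← mul_assoc, hu.mul]
    simp
  have h2 : ∀ f : B → B, (∀ x y, f (x + y) = f x + f y) → (∀ (c : ℂ) x, f (c • x) = c • f x) →
      f (matRep u X) = ∑ a, ∑ b, X a b • f (u a b) := by
    intro f ha hs
    let F : B →ₗ[ℂ] B := ⟨⟨f, ha⟩, hs⟩
    change F _ = ∑ a, ∑ b, X a b • F _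
    simp [matRep]
  rw [h2 fun z => ∑ w, ∑ v, u w v * (z * y) * u v w, h2 fun z => ∑ w, ∑ v, u w v * (y * z) * u v w]
  · simp only [h1]
  all_goals intros; simp only [mul_add, add_mul, Finset.sum_add_distrib, smul_mul_assoc,
    mul_smul_comm, Finset.smul_sum]

theorem MatUnits.siteTr_comm {u : ι → ι → B} (hu : MatUnits u) {C X : Matrix ι ι ℂ}
    (h : C * X = X * C) (y : B) :
    siteTr C u (matRep u X * y) = siteTr C u (y * matRep u X) := by
  rw [hu.siteTr_eq, hu.siteTr_eq, mul_assoc, hu.sum_unit_comm, mul_assoc, mul_assoc,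
    ← hu.matRep_mul, ← hu.matRep_mul, h]

theorem siteTr_matRep {f : ι → ι → B} {g : κ → κ → B} (hg : MatUnits g)
    (hfg : ∀ a b c d, f a b * g c d = g c d * f a b) (C : Matrix κ κ ℂ)
    (X : Matrix (ι × κ) (ι × κ) ℂ) :
    siteTr C g (matRep (prodUnits f g) X) = matRep f (ptrace C X) := by
  simp only [matRep, siteTr_sum, siteTr_smul, prodUnits, Fintype.sum_prod_type, ptrace,
    Matrix.of_apply, Finset.sum_smul]
  refine Finset.sum_congr rfl fun a _ => ?_
  rw [Finset.sum_comm]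
  refine Finset.sum_congr rfl fun c _ => Finset.sum_congr rfl fun b _ =>
    Finset.sum_congr rfl fun d _ => ?_
  rw [siteTr_mul_left _ (fun _ _ => (hfg _ _ _ _).symm), hg.siteTr_unit, mul_smul_comm, mul_one,
    smul_smul]

theorem matRep_prodUnits_comm {f : ι → ι → B} {g : κ → κ → B} {y : B}
    (hf : ∀ a b, f a b * y = y * f a b) (hg : ∀ a b, g a b * y = y * g a b)
    (X : Matrix (ι × κ) (ι × κ) ℂ) :
    matRep (prodUnits f g) X * y = y * matRep (prodUnits f g) X := by
  simp only [matRep, prodUnits, Finset.sum_mul, Finset.mul_sum, smul_mul_assoc, mul_smul_comm]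
  simp only [mul_assoc, hg]
  simp only [← mul_assoc, hf]

theorem matRep_prodUnits_single {f : ι → ι → B} {g : κ → κ → B} (hg : MatUnits g) (a b : ι) :
    matRep (prodUnits f g) (Matrix.kroneckerMap (· * ·) (Matrix.single a b 1) 1) = f a b := by
  simp only [matRep, prodUnits, Fintype.sum_prod_type, Matrix.kroneckerMap_apply,
    Matrix.single_apply, Matrix.one_apply, mul_ite, mul_one, mul_zero, ite_smul, one_smul,
    zero_smul]
  simp only [Finset.sum_ite_eq, Finset.mem_univ, if_true]
  calc _ = ∑ x, ∑ y, ∑ c, (if a = x ∧ b = y then f x y * g c c else 0) :=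
        Finset.sum_congr rfl fun x _ => Finset.sum_comm
    _ = ∑ x, ∑ y, (if a = x ∧ b = y then f x y else 0) := by
        refine Finset.sum_congr rfl fun x _ => Finset.sum_congr rfl fun y _ => ?_
        split_ifs
        · rw [← Finset.mul_sum, hg.sum, mul_one]
        · simp
    _ = f a b := by
        rw [Finset.sum_eq_single a, Finset.sum_eq_single b] <;> simp +contextual [eq_comm]

end MatUnits

section SkewInvertible

variable {N : ℕ}

local notation "Mat₂" => Matrix (Fin N × Fin N) (Fin N × Fin N) ℂ

theorem sum_comm_two_two {κ B : Type*} [Fintype κ] [AddCommMonoid B] (f : κ → κ → κ → κ → B) :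
    ∑ x, ∑ y, ∑ b, ∑ d, f x y b d = ∑ b, ∑ d, ∑ x, ∑ y, f x y b d := by
  calc _ = ∑ x, ∑ b, ∑ y, ∑ d, f x y b d := Finset.sum_congr rfl fun x _ => Finset.sum_comm
    _ = ∑ b, ∑ x, ∑ y, ∑ d, f x y b d := Finset.sum_comm
    _ = ∑ b, ∑ x, ∑ d, ∑ y, f x y b d := Finset.sum_congr rfl fun b _ =>
        Finset.sum_congr rfl fun x _ => Finset.sum_comm
    _ = _ := Finset.sum_congr rfl fun b _ => Finset.sum_comm

theorem sum_assoc_right {κ : Type*} [Fintype κ] (F G H : κ → κ → ℂ) :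
    ∑ k, ∑ n', (∑ n, F k n * G n n') * H n' k = ∑ k, ∑ n, F k n * ∑ n', G n n' * H n' k := by
  refine Finset.sum_congr rfl fun k _ => ?_
  simp only [Finset.sum_mul, Finset.mul_sum, mul_assoc]
  exact Finset.sum_comm

theorem sum_assoc_left {κ : Type*} [Fintype κ] (F G H : κ → κ → ℂ) :
    ∑ k, ∑ n', (∑ n, F k n * G n n') * H n' k = ∑ n, ∑ n', G n n' * ∑ k, H n' k * F k n := by
  simp only [Finset.sum_mul, Finset.mul_sum]
  calc _ = ∑ n', ∑ k, ∑ n, F k n * G n n' * H n' k := Finset.sum_comm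
    _ = ∑ n', ∑ n, ∑ k, F k n * G n n' * H n' k := Finset.sum_congr rfl fun _ _ => Finset.sum_comm
    _ = ∑ n, ∑ n', ∑ k, F k n * G n n' * H n' k := Finset.sum_comm
    _ = _ := Finset.sum_congr rfl fun _ _ => Finset.sum_congr rfl fun _ _ =>
        Finset.sum_congr rfl fun _ _ => by ring

theorem sum_contract {κ : Type*} [Fintype κ] (F : κ → κ → ℂ) (G : κ → κ → κ → κ → ℂ)
    (H : κ → κ → ℂ) :
    ∑ a, ∑ i, F a i * ∑ k, ∑ n, G a i k n * H k n =
      ∑ k, ∑ n, (∑ a, ∑ i, F a i * G a i k n) * H k n := by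
  simp only [Finset.mul_sum, Finset.sum_mul, ← mul_assoc]
  exact sum_comm_two_two _

/-- A matrix unit in the first tensor factor. -/
def unitFst (a b : Fin N) : Mat₂ := Matrix.kroneckerMap (· * ·) (Matrix.single a b 1) 1

theorem conj_single_apply (R S : Mat₂) (a b : Fin N) (x y : Fin N × Fin N) :
    (R * unitFst a b * S) x y =
      ∑ n, R x (a, n) * S (b, n) y := by
  have h : ∀ z, (R * unitFst a b) x z = if b = z.1 then R x (a, z.2) else 0 := by
    intro z
    simp only [Matrix.mul_apply, Fintype.sum_prod_type, unitFst, Matrix.kroneckerMap_apply,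
      Matrix.single_apply, Matrix.one_apply]
    rw [Finset.sum_eq_single a]
    · rw [Finset.sum_eq_single z.2] <;> simp +contextual
    · intro c _ hc; simp [hc.symm]
    · simp
  rw [Matrix.mul_apply, Fintype.sum_prod_type, Finset.sum_eq_single b]
  · simp [h]
  · intro c _ hc; simp [h, hc.symm]
  · simp

theorem ptrace_traceMat {R Ψ : Mat₂} (hΨ : SkewInv N R Ψ) : ptrace (traceMat N Ψ) R = 1 := by
  ext a c
  simp only [ptrace, traceMat, Matrix.of_apply, Finset.mul_sum]
  calc _ = ∑ b, ∑ k, ∑ d, R (a, b) (c, d) * Ψ (d, k) (b, k) :=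
        Finset.sum_congr rfl fun b _ => Finset.sum_comm
    _ = ∑ k, ∑ b, ∑ d, R (a, b) (c, d) * Ψ (d, k) (b, k) := Finset.sum_comm
    _ = ∑ k, if a = k ∧ k = c then (1 : ℂ) else 0 :=
        Finset.sum_congr rfl fun k _ => hΨ.1 a k c k
    _ = _ := by
        simp only [Matrix.one_apply, ite_and]
        simp

variable {B : Type*} [Ring B] [Algebra ℂ B]

theorem siteTr_conj_unit {f g : Fin N → Fin N → B} (hf : MatUnits f) (hg : MatUnits g)
    (hfg : ∀ a b c d, f a b * g c d = g c d * f a b) (C : Matrix (Fin N) (Fin N) ℂ) (X Y : Mat₂)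
    (a b : Fin N) :
    siteTr C g (matRep (prodUnits f g) X * f a b * matRep (prodUnits f g) Y) =
      matRep f (ptrace C
        (X * unitFst a b * Y)) := by
  rw [← siteTr_matRep hg hfg, (hf.prod hg hfg).matRep_mul, (hf.prod hg hfg).matRep_mul,
    show matRep (prodUnits f g) (unitFst a b) = f a b from matRep_prodUnits_single hg a b]

theorem ptrace_conj_of_siteTr [Nontrivial B] {R Ψ : Mat₂} (hΨ : SkewInv N R Ψ)
    {e f g : Fin N → Fin N → B} (he : MatUnits e) (hf : MatUnits f) (hg : MatUnits g)
    (hef : ∀ a b c d, e a b * f c d = f c d * e a b)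
    (heg : ∀ a b c d, e a b * g c d = g c d * e a b)
    (hfg : ∀ a b c d, f a b * g c d = g c d * f a b) {X Y : Mat₂}
    (h : siteTr (traceMat N Ψ) g (matRep (prodUnits f g) X * matRep (prodUnits e f) R *
      matRep (prodUnits f g) Y) = 1) (a b : Fin N) :
    ptrace (traceMat N Ψ) (X * unitFst a b * Y) =
      traceMat N Ψ b a • 1 := by
  set G : Fin N → Fin N → Matrix (Fin N) (Fin N) ℂ := fun b d => ptrace (traceMat N Ψ)
    (X * unitFst b d * Y) with hG
  change G a b = _
  have hexp : matRep (prodUnits e f) (Matrix.of fun x y : Fin N × Fin N =>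
      ∑ b, ∑ d, R (x.1, b) (y.1, d) * G b d x.2 y.2) = matRep (prodUnits e f) 1 := by
    rw [(he.prod hf hef).matRep_one, ← h]
    have h1 : ∀ a c b d, siteTr (traceMat N Ψ) g (matRep (prodUnits f g) X * (e a c * f b d) *
        matRep (prodUnits f g) Y) = e a c * matRep f (G b d) := by
      intro a c b d
      rw [← mul_assoc, matRep_prodUnits_comm (fun _ _ => (hef _ _ _ _).symm)
        (fun _ _ => (heg _ _ _ _).symm), mul_assoc, mul_assoc,
        siteTr_mul_left _ (fun _ _ => (heg _ _ _ _).symm), ← mul_assoc,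
        siteTr_conj_unit hf hg hfg]
    have h2 : matRep (prodUnits e f) R = ∑ a, ∑ b, ∑ c, ∑ d, R (a, b) (c, d) • (e a c * f b d) := by
      simp only [matRep, prodUnits, Fintype.sum_prod_type]
    rw [h2]
    simp only [Finset.mul_sum, Finset.sum_mul, siteTr_sum, mul_smul_comm, smul_mul_assoc,
      siteTr_smul, h1]
    simp only [matRep, prodUnits, Fintype.sum_prod_type, Matrix.of_apply, Finset.mul_sum,
      Finset.smul_sum, Finset.sum_smul, mul_smul_comm, smul_smul]
    refine Finset.sum_congr rfl fun a _ => ?_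
    calc _ = ∑ c, ∑ x, ∑ y, ∑ b, ∑ d, (R (a, b) (c, d) * G b d x y) • (e a c * f x y) :=
          Finset.sum_comm
      _ = ∑ c, ∑ b, ∑ d, ∑ x, ∑ y, (R (a, b) (c, d) * G b d x y) • (e a c * f x y) := by
          exact Finset.sum_congr rfl fun c _ => sum_comm_two_two _
      _ = _ := Finset.sum_comm
  have hco := (he.prod hf hef).matRep_injective hexp
  ext x y
  have h3 : ∀ c d, ∑ b, ∑ d', R (c, b) (d, d') * G b d' x y =
      (1 : Mat₂) (c, x) (d, y) := fun c d => congrFun (congrFun hco (c, x)) (d, y)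
  have h4 : ∑ d, ∑ c, Ψ (b, d) (a, c) * (∑ s, ∑ t, R (c, s) (d, t) * G s t x y) = G a b x y := by
    calc _ = ∑ s, ∑ t, (∑ d, ∑ c, Ψ (b, d) (a, c) * R (c, s) (d, t)) * G s t x y := by
          exact sum_contract (fun d c => Ψ (b, d) (a, c)) (fun d c s t => R (c, s) (d, t))
            (fun s t => G s t x y)
      _ = ∑ s, ∑ t, (if b = t ∧ s = a then 1 else 0) * G s t x y := by
          simp only [hΨ.2]
      _ = _ := by
          rw [Finset.sum_eq_single a, Finset.sum_eq_single b] <;> simp +contextual [eq_comm]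
  rw [← h4]
  simp only [h3, Matrix.one_apply, Prod.mk.injEq, Matrix.smul_apply, traceMat, Matrix.of_apply,
    smul_eq_mul, Finset.sum_mul, ite_and]
  simp

theorem traceMat_kronecker_comm {R S Ψ : Mat₂} (hΨ : SkewInv N R Ψ)
    (h1 : ∀ a b, ptrace (traceMat N Ψ)
      (R * unitFst a b * S) = traceMat N Ψ b a • 1)
    (h2 : ∀ a b, ptrace (traceMat N Ψ)
      (S * unitFst a b * R) = traceMat N Ψ b a • 1) :
    Matrix.kroneckerMap (· * ·) (traceMat N Ψ) (traceMat N Ψ) * S =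
      S * Matrix.kroneckerMap (· * ·) (traceMat N Ψ) (traceMat N Ψ) := by
  set C := traceMat N Ψ
  have k1 : ∀ i l b a, ∑ k, ∑ n, R (i, k) (a, n) * (∑ n', S (b, n) (l, n') * C n' k) =
      if i = l then C b a else 0 := by
    intro i l b a
    have := congrFun (congrFun (h1 a b) i) l
    simp only [ptrace, conj_single_apply, Matrix.of_apply, Matrix.smul_apply, Matrix.one_apply,
      smul_eq_mul, mul_ite, mul_one, mul_zero] at this
    rw [← this]
    exact (sum_assoc_right (fun k n => R (i, k) (a, n)) (fun n n' => S (b, n) (l, n')) C).symm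
  have k2 : ∀ i l b a, ∑ n, ∑ n', R (b, n) (l, n') * (∑ k, C n' k * S (i, k) (a, n)) =
      if i = l then C b a else 0 := by
    intro i l b a
    have := congrFun (congrFun (h2 a b) i) l
    simp only [ptrace, conj_single_apply, Matrix.of_apply, Matrix.smul_apply, Matrix.one_apply,
      smul_eq_mul, mul_ite, mul_one, mul_zero] at this
    rw [← this]
    exact (sum_assoc_left (fun k n => S (i, k) (a, n)) (fun n n' => R (b, n) (l, n')) C).symm
  have g1 : ∀ b l s t, ∑ n', S (b, s) (l, n') * C n' t = ∑ a, Ψ (s, a) (t, l) * C b a := by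
    intro b l s t
    symm
    calc ∑ a, Ψ (s, a) (t, l) * C b a =
          ∑ a, ∑ i, Ψ (s, a) (t, i) * (if i = l then C b a else 0) := by simp
      _ = ∑ a, ∑ i, Ψ (s, a) (t, i) *
          ∑ k, ∑ n, R (i, k) (a, n) * (∑ n', S (b, n) (l, n') * C n' k) := by simp only [k1]
      _ = ∑ k, ∑ n, (∑ a, ∑ i, Ψ (s, a) (t, i) * R (i, k) (a, n)) *
          (∑ n', S (b, n) (l, n') * C n' k) := sum_contract (fun a i => Ψ (s, a) (t, i))
            (fun a i k n => R (i, k) (a, n)) (fun k n => ∑ n', S (b, n) (l, n') * C n' k)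
      _ = ∑ k, ∑ n, (if s = n ∧ k = t then 1 else 0) * (∑ n', S (b, n) (l, n') * C n' k) := by
          simp only [hΨ.2]
      _ = _ := by
          rw [Finset.sum_eq_single t, Finset.sum_eq_single s] <;> simp +contextual [eq_comm]
  have g2 : ∀ i a s t, ∑ k, C s k * S (i, k) (a, t) = ∑ b, Ψ (s, i) (t, b) * C b a := by
    intro i a s t
    symm
    calc ∑ b, Ψ (s, i) (t, b) * C b a =
          ∑ l, ∑ b, Ψ (s, l) (t, b) * (if i = l then C b a else 0) := by
          rw [Finset.sum_comm]; simp
      _ = ∑ l, ∑ b, Ψ (s, l) (t, b) *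
          ∑ n, ∑ n', R (b, n) (l, n') * (∑ k, C n' k * S (i, k) (a, n)) := by simp only [k2]
      _ = ∑ n, ∑ n', (∑ l, ∑ b, Ψ (s, l) (t, b) * R (b, n) (l, n')) *
          (∑ k, C n' k * S (i, k) (a, n)) := sum_contract (fun l b => Ψ (s, l) (t, b))
            (fun l b n n' => R (b, n) (l, n')) (fun n n' => ∑ k, C n' k * S (i, k) (a, n))
      _ = ∑ n, ∑ n', (if s = n' ∧ n = t then 1 else 0) * (∑ k, C n' k * S (i, k) (a, n)) := by
          simp only [hΨ.2]
      _ = _ := by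
          rw [Finset.sum_eq_single t, Finset.sum_eq_single s] <;> simp +contextual [eq_comm]
  ext ⟨i, s⟩ ⟨a, t⟩
  simp only [Matrix.mul_apply, Fintype.sum_prod_type, Matrix.kroneckerMap_apply]
  calc _ = ∑ x, C i x * ∑ y, C s y * S (x, y) (a, t) := by
        simp only [Finset.mul_sum, mul_assoc]
    _ = ∑ x, ∑ b, C i x * (Ψ (s, x) (t, b) * C b a) := by simp only [g2, Finset.mul_sum]
    _ = ∑ b, ∑ x, C i x * (Ψ (s, x) (t, b) * C b a) := Finset.sum_comm
    _ = ∑ b, C b a * ∑ y, S (i, s) (b, y) * C y t := by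
        simp only [g1, Finset.mul_sum]
        exact Finset.sum_congr rfl fun b _ => Finset.sum_congr rfl fun x _ => by ring
    _ = _ := by
        simp only [Finset.mul_sum]
        exact Finset.sum_congr rfl fun b _ => Finset.sum_congr rfl fun x _ => by ring

end SkewInvertible

section BraidTower

variable {N n : ℕ} {B : Type*} [Ring B] [Algebra ℂ B] {q : ℂ} {C : Matrix (Fin N) (Fin N) ℂ}
  {e : ℕ → Fin N → Fin N → B} {r s : ℕ → B}

/-- Hecke braid generators `r i` acting at the sites `i, i + 1` of a tower of `n` commuting systems
of matrix units, together with the compatibilities with the weighted traces over the sites. -/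
structure BraidTower (n : ℕ) (q : ℂ) (C : Matrix (Fin N) (Fin N) ℂ)
    (e : ℕ → Fin N → Fin N → B) (r s : ℕ → B) : Prop where
  units : ∀ i, i < n → MatUnits (e i)
  comm : ∀ i j, i < n → j < n → i ≠ j → ∀ a b c d, e i a b * e j c d = e j c d * e i a b
  r_mul_s : ∀ i, r i * s i = 1
  s_mul_r : ∀ i, s i * r i = 1
  r_comm : ∀ i, i + 1 < n → ∀ y, (∀ a b, e i a b * y = y * e i a b) →
    (∀ a b, e (i + 1) a b * y = y * e (i + 1) a b) → r i * y = y * r i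
  hecke : ∀ i, i + 1 < n → r i * r i = (q - q⁻¹) • r i + 1
  braid : ∀ i, i + 2 < n → r i * r (i + 1) * r i = r (i + 1) * r i * r (i + 1)
  tr_r : ∀ i, i + 1 < n → siteTr C (e (i + 1)) (r i) = 1
  tr_conj : ∀ i, i + 1 < n → ∀ a b,
    siteTr C (e (i + 1)) (r i * e i a b * s i) = C b a • 1
  cyclic : ∀ i, i + 1 < n → ∀ y, siteTr C (e i) (siteTr C (e (i + 1)) (r i * y)) =
    siteTr C (e i) (siteTr C (e (i + 1)) (y * r i))

/-- The elements acting trivially at the site `i`. -/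
def site (e : ℕ → Fin N → Fin N → B) (i : ℕ) : Subalgebra ℂ B :=
  Subalgebra.centralizer ℂ {y | ∃ a b, y = e i a b}

/-- The subalgebra generated by the `r i` with `a ≤ i` and `i + 1 < p`. -/
def seg (r : ℕ → B) (a p : ℕ) : Subalgebra ℂ B :=
  Algebra.adjoin ℂ {x | ∃ i, a ≤ i ∧ i + 1 < p ∧ x = r i}

/-- The iterated trace over the sites `a, …, a + l - 1`. -/
def iterTr (C : Matrix (Fin N) (Fin N) ℂ) (e : ℕ → Fin N → Fin N → B) (a : ℕ) : ℕ → B → B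
  | 0, x => x
  | l + 1, x => iterTr C e a l (siteTr C (e (a + l)) x)

/-- The product `r a * r (a + 1) * ⋯ * r (a + l - 1)`. -/
def ascProd (r : ℕ → B) (a : ℕ) : ℕ → B
  | 0 => 1
  | l + 1 => ascProd r a l * r (a + l)

/-- The product `s (a + l - 1) * ⋯ * s (a + 1) * s a`. -/
def descProd (s : ℕ → B) (a : ℕ) : ℕ → B
  | 0 => 1
  | l + 1 => s (a + l) * descProd s a l

/-- The copies of `X` obtained by successive conjugation. -/
def conjCopy (r s : ℕ → B) (X : B) : ℕ → B
  | 0 => X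
  | t + 1 => r t * conjCopy r s X t * s t

/-- The product of the copies with indices `a, …, a + l - 1`. -/
def copyProd (r s : ℕ → B) (X : B) (a : ℕ) : ℕ → B
  | 0 => 1
  | l + 1 => copyProd r s X a l * conjCopy r s X (a + l)

theorem mem_site {i : ℕ} {x : B} : x ∈ site e i ↔ ∀ a b, e i a b * x = x * e i a b := by
  rw [site, Subalgebra.mem_centralizer_iff]
  exact ⟨fun h a b => h _ ⟨a, b, rfl⟩, by rintro h _ ⟨a, b, rfl⟩; exact h a b⟩

theorem seg_mono {a a' p p' : ℕ} (ha : a' ≤ a) (hp : p ≤ p') : seg r a p ≤ seg r a' p' := by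
  apply Algebra.adjoin_mono
  rintro _ ⟨i, h1, h2, rfl⟩
  exact ⟨i, by omega, by omega, rfl⟩

theorem r_mem_seg {a p i : ℕ} (h1 : a ≤ i) (h2 : i + 1 < p) : r i ∈ seg r a p :=
  Algebra.subset_adjoin ⟨i, h1, h2, rfl⟩

theorem seg_commute {a p : ℕ} {y : B} (h : ∀ i, a ≤ i → i + 1 < p → r i * y = y * r i) {x : B}
    (hx : x ∈ seg r a p) : x * y = y * x := by
  have hle : seg r a p ≤ Subalgebra.centralizer ℂ {y} := by
    apply Algebra.adjoin_le
    rintro _ ⟨i, h1, h2, rfl⟩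
    rw [SetLike.mem_coe, Subalgebra.mem_centralizer_iff]
    rintro _ rfl
    exact (h i h1 h2).symm
  exact ((Subalgebra.mem_centralizer_iff ℂ).1 (hle hx) y rfl).symm

theorem iterTr_add (a l : ℕ) (x y : B) :
    iterTr C e a l (x + y) = iterTr C e a l x + iterTr C e a l y := by
  induction l generalizing x y with
  | zero => rfl
  | succ l ih => simp [iterTr, siteTr_add, ih]

theorem iterTr_smul (a l : ℕ) (c : ℂ) (x : B) :
    iterTr C e a l (c • x) = c • iterTr C e a l x := by
  induction l generalizing x with
  | zero => rfl
  | succ l ih => simp [iterTr, siteTr_smul, ih]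

theorem iterTr_append (a l l' : ℕ) (x : B) :
    iterTr C e a (l + l') x = iterTr C e a l (iterTr C e (a + l) l' x) := by
  induction l' generalizing x with
  | zero => rfl
  | succ l' ih => rw [← add_assoc, iterTr, ih, ← add_assoc, iterTr]

theorem iterTr_mul_left {a l : ℕ} {x : B} (hx : ∀ j, a ≤ j → j < a + l → x ∈ site e j) (y : B) :
    iterTr C e a l (x * y) = x * iterTr C e a l y := by
  induction l generalizing y with
  | zero => rfl
  | succ l ih =>
    rw [iterTr, iterTr, siteTr_mul_left _ (mem_site.1 (hx _ (by omega) (by omega))),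
      ih fun j h1 h2 => hx j h1 (by omega)]

theorem iterTr_mul_right {a l : ℕ} {x : B} (hx : ∀ j, a ≤ j → j < a + l → x ∈ site e j) (y : B) :
    iterTr C e a l (y * x) = iterTr C e a l y * x := by
  induction l generalizing y with
  | zero => rfl
  | succ l ih =>
    rw [iterTr, iterTr, siteTr_mul_right _ (mem_site.1 (hx _ (by omega) (by omega))),
      ih fun j h1 h2 => hx j h1 (by omega)]

/-- The linear span of the products `u` and `u * r p * v` with `u`, `v` in the subalgebra generated
by the `r i` with `i < p`. -/
def markovSpan (r : ℕ → B) (p : ℕ) : Submodule ℂ B :=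
  Submodule.span ℂ {z | z ∈ seg r 0 (p + 1) ∨
    ∃ u ∈ seg r 0 (p + 1), ∃ v ∈ seg r 0 (p + 1), z = u * r p * v}

theorem markovSpan_mul_right {p : ℕ} {x y : B} (hx : x ∈ markovSpan r p)
    (hy : y ∈ seg r 0 (p + 1)) : x * y ∈ markovSpan r p := by
  induction hx using Submodule.span_induction with
  | mem x hx =>
    rcases hx with hx | ⟨u, hu, v, hv, rfl⟩
    · exact Submodule.subset_span (Or.inl (mul_mem hx hy))
    · exact Submodule.subset_span (Or.inr ⟨u, hu, v * y, mul_mem hv hy, by rw [mul_assoc]⟩)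
  | zero => rw [zero_mul]; exact zero_mem _
  | add x y _ _ hx hy => rw [add_mul]; exact add_mem hx hy
  | smul c x _ hx => rw [smul_mul_assoc]; exact Submodule.smul_mem _ _ hx

namespace BraidTower

variable (T : BraidTower n q C e r s)
include T

theorem e_mem_site {i j : ℕ} (hi : i < n) (hj : j < n) (hij : i ≠ j) (a b : Fin N) :
    e i a b ∈ site e j :=
  mem_site.2 fun _ _ => (T.comm j i hj hi hij.symm _ _ _ _)

theorem r_mul_comm {i : ℕ} (hi : i + 1 < n) {y : B} (h1 : y ∈ site e i)
    (h2 : y ∈ site e (i + 1)) : r i * y = y * r i :=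
  T.r_comm i hi y (mem_site.1 h1) (mem_site.1 h2)

theorem r_mem_site {i j : ℕ} (hi : i + 1 < n) (hj : j < n) (h1 : j ≠ i) (h2 : j ≠ i + 1) :
    r i ∈ site e j :=
  mem_site.2 fun a b => (T.r_mul_comm hi (T.e_mem_site hj (by omega) h1 a b)
    (T.e_mem_site hj hi h2 a b)).symm

theorem s_eq {i : ℕ} (hi : i + 1 < n) : s i = r i - (q - q⁻¹) • 1 := by
  have h : r i * (r i - (q - q⁻¹) • 1) = 1 := by
    rw [mul_sub, T.hecke i hi, mul_smul_comm, mul_one]; abel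
  calc s i = s i * (r i * (r i - (q - q⁻¹) • 1)) := by rw [h, mul_one]
    _ = _ := by rw [← mul_assoc, T.s_mul_r, one_mul]

theorem s_mem {i : ℕ} (hi : i + 1 < n) {S : Subalgebra ℂ B} (h : r i ∈ S) : s i ∈ S := by
  rw [T.s_eq hi]
  exact S.sub_mem h (S.smul_mem S.one_mem _)

theorem s_comm_of_r_comm {i : ℕ} {y : B} (h : r i * y = y * r i) : s i * y = y * s i := by
  calc s i * y = s i * (y * r i) * s i := by
        rw [mul_assoc, mul_assoc, T.r_mul_s, mul_one]
    _ = y * s i := by rw [← h, ← mul_assoc, T.s_mul_r, one_mul]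

theorem r_r_comm {i j : ℕ} (hi : i + 1 < n) (hj : j + 1 < n) (h : i + 1 < j) :
    r i * r j = r j * r i :=
  T.r_mul_comm hi (T.r_mem_site hj (by omega) (by omega) (by omega))
    (T.r_mem_site hj (by omega) (by omega) (by omega))

theorem seg_le_site {a p j : ℕ} (hp : p ≤ n) (hj : j < n) (h : j < a ∨ p ≤ j) :
    seg r a p ≤ site e j := by
  apply Algebra.adjoin_le
  rintro _ ⟨i, h1, h2, rfl⟩
  exact T.r_mem_site (by omega) hj (by omega) (by omega)

theorem siteTr_mem_site {i j : ℕ} (hi : i < n) (hj : j < n) {x : B} (hx : x ∈ site e j) :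
    siteTr C (e i) x ∈ site e j := by
  by_cases hij : i = j
  · subst hij
    exact mem_site.2 fun a b => (T.units i hi).unit_mul_siteTr C x a b
  · refine Subalgebra.sum_mem _ fun a _ => Subalgebra.sum_mem _ fun b _ =>
      Subalgebra.sum_mem _ fun w _ => Subalgebra.smul_mem _ (mul_mem (mul_mem ?_ hx) ?_) _
    all_goals exact T.e_mem_site hi hj hij _ _

theorem siteTr_mem_site_self {i : ℕ} (hi : i < n) (x : B) : siteTr C (e i) x ∈ site e i :=
  mem_site.2 fun a b => (T.units i hi).unit_mul_siteTr C x a b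

theorem siteTr_conj {i : ℕ} (hi : i + 1 < n) {x : B} (hx : x ∈ site e (i + 1)) :
    siteTr C (e (i + 1)) (r i * x * s i) = siteTr C (e i) x := by
  have hu := T.units i (by omega)
  set y : Fin N → Fin N → B := fun a b => ∑ w, e i w a * x * e i b w with hy
  have hy0 : ∀ a b, y a b ∈ site e i := by
    intro a b
    refine mem_site.2 fun c d => ?_
    simp only [hy, Finset.mul_sum, Finset.sum_mul, mul_assoc, hu.mul]
    simp only [← mul_assoc, hu.mul]
    simp
  have hy1 : ∀ a b, y a b ∈ site e (i + 1) := fun a b => Subalgebra.sum_mem _ fun w _ =>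
    mul_mem (mul_mem (T.e_mem_site (by omega) hi (by omega) _ _) hx)
      (T.e_mem_site (by omega) hi (by omega) _ _)
  have hx' : x = ∑ a, ∑ b, e i a b * y a b := by
    simp only [hy, Finset.mul_sum, ← mul_assoc, hu.mul, ite_mul, zero_mul]
    simp only [Finset.sum_ite_eq, Finset.mem_univ, if_true]
    simp only [← Finset.mul_sum, hu.sum, mul_one, ← Finset.sum_mul, one_mul]
  have key : ∀ a b, siteTr C (e (i + 1)) (r i * (e i a b * y a b) * s i) = C b a • y a b := by
    intro a b
    rw [← mul_assoc, mul_assoc, ← T.s_comm_of_r_comm (T.r_mul_comm hi (hy0 a b) (hy1 a b)),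
      ← mul_assoc, siteTr_mul_right _ (mem_site.1 (hy1 a b)), T.tr_conj i hi, smul_mul_assoc,
      one_mul]
  conv_lhs => rw [hx']
  simp only [Finset.mul_sum, Finset.sum_mul, siteTr_sum, key]
  simp only [siteTr, hy, Finset.smul_sum]
  exact Finset.sum_comm

theorem seg_le_markovSpan_of {p : ℕ} (h : ∀ x ∈ seg r 0 (p + 1), r p * x * r p ∈ markovSpan r p)
    {x : B} (hx : x ∈ seg r 0 (p + 2)) : x ∈ markovSpan r p := by
  have left_mul : ∀ x ∈ seg r 0 (p + 2), ∀ w ∈ markovSpan r p, x * w ∈ markovSpan r p := by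
    intro x hx
    induction hx using Algebra.adjoin_induction with
    | mem x hx =>
      obtain ⟨i, -, hi, rfl⟩ := hx
      intro w hw
      induction hw using Submodule.span_induction with
      | mem w hw =>
        by_cases hip : i = p
        · subst hip
          rcases hw with hw | ⟨u, hu, v, hv, rfl⟩
          · exact Submodule.subset_span (Or.inr ⟨1, one_mem _, w, hw, by rw [one_mul]⟩)
          · rw [← mul_assoc, ← mul_assoc]
            exact markovSpan_mul_right (h u hu) hv
        · have hri : r i ∈ seg r 0 (p + 1) := r_mem_seg (Nat.zero_le _) (by omega)
          rcases hw with hw | ⟨u, hu, v, hv, rfl⟩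
          · exact Submodule.subset_span (Or.inl (mul_mem hri hw))
          · exact Submodule.subset_span (Or.inr ⟨_, mul_mem hri hu, v, hv, by
              simp only [mul_assoc]⟩)
      | zero => rw [mul_zero]; exact zero_mem _
      | add x y _ _ hx hy => rw [mul_add]; exact add_mem hx hy
      | smul c x _ hx => rw [mul_smul_comm]; exact Submodule.smul_mem _ _ hx
    | algebraMap c =>
      intro w hw
      rw [← Algebra.smul_def]
      exact Submodule.smul_mem _ _ hw
    | add x y _ _ hx hy => intro w hw; rw [add_mul]; exact add_mem (hx w hw) (hy w hw)
    | mul x y _ _ hx hy => intro w hw; rw [mul_assoc]; exact hx _ (hy w hw)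
  rw [← mul_one x]
  exact left_mul x hx 1 (Submodule.subset_span (Or.inl (one_mem _)))

theorem r_mul_mul_r_mem {p : ℕ} (hp : p + 1 < n) :
    ∀ x ∈ seg r 0 (p + 1), r p * x * r p ∈ markovSpan r p := by
  have comm_case : ∀ p, p + 1 < n → ∀ x ∈ seg r 0 p, r p * x * r p ∈ markovSpan r p := by
    intro p hp x hx
    have hx' : x ∈ seg r 0 (p + 1) := seg_mono le_rfl (Nat.le_succ p) hx
    rw [← seg_commute (fun i _ hi => T.r_r_comm (by omega) hp hi) hx, mul_assoc, T.hecke p hp,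
      mul_add, mul_one, mul_smul_comm]
    exact add_mem (Submodule.smul_mem _ _ (Submodule.subset_span
      (Or.inr ⟨x, hx', 1, one_mem _, by rw [mul_one]⟩))) (Submodule.subset_span (Or.inl hx'))
  induction p with
  | zero =>
    intro x hx
    refine comm_case 0 hp x (Algebra.adjoin_mono ?_ hx)
    rintro _ ⟨i, _, h2, rfl⟩
    omega
  | succ p ih =>
    intro x hx
    replace hx := T.seg_le_markovSpan_of (ih (by omega)) hx
    induction hx using Submodule.span_induction with
    | mem x hx =>
      rcases hx with hx | ⟨u, hu, v, hv, rfl⟩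
      · exact comm_case _ hp x hx
      · have hc : ∀ y ∈ seg r 0 (p + 1), y * r (p + 1) = r (p + 1) * y := fun y hy =>
          seg_commute (fun i _ hi => T.r_r_comm (by omega) hp hi) hy
        have h1 : r (p + 1) * (u * r p * v) * r (p + 1) =
            u * r p * r (p + 1) * (r p * v) := by
          calc _ = (r (p + 1) * u) * r p * (v * r (p + 1)) := by simp only [mul_assoc]
            _ = u * (r (p + 1) * r p * r (p + 1)) * v := by
              rw [← hc u hu, hc v hv]; simp only [mul_assoc]
            _ = _ := by rw [← T.braid p hp]; simp only [mul_assoc]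
        have hrp : r p ∈ seg r 0 (p + 2) := r_mem_seg (Nat.zero_le _) (by omega)
        rw [h1]
        exact Submodule.subset_span (Or.inr ⟨_, mul_mem (seg_mono le_rfl (Nat.le_succ _) hu) hrp,
          _, mul_mem hrp (seg_mono le_rfl (Nat.le_succ _) hv), rfl⟩)
    | zero => rw [mul_zero, zero_mul]; exact zero_mem _
    | add x y _ _ hx hy => rw [mul_add, add_mul]; exact add_mem hx hy
    | smul c x _ hx => rw [mul_smul_comm, smul_mul_assoc]; exact Submodule.smul_mem _ _ hx

theorem siteTr_seg {p : ℕ} (hp : p < n) {x : B} (hx : x ∈ seg r 0 (p + 1)) :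
    siteTr C (e p) x ∈ seg r 0 p := by
  have one_case : ∀ x ∈ seg r 0 p, siteTr C (e p) x ∈ seg r 0 p := by
    intro x hx
    have := siteTr_mul_left C (mem_site.1 (T.seg_le_site hp.le hp (Or.inr le_rfl) hx)) 1
    rw [mul_one, (T.units p hp).siteTr_one] at this
    rw [this]
    exact mul_mem hx (Subalgebra.smul_mem _ (one_mem _) _)
  cases p with
  | zero =>
    refine one_case x (Algebra.adjoin_mono ?_ hx)
    rintro _ ⟨i, _, h2, rfl⟩
    omega
  | succ p =>
    replace hx := T.seg_le_markovSpan_of (T.r_mul_mul_r_mem hp) hx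
    induction hx using Submodule.span_induction with
    | mem x hx =>
      rcases hx with hx | ⟨u, hu, v, hv, rfl⟩
      · exact one_case x hx
      · have hs := T.seg_le_site hp.le hp (a := 0) (Or.inr le_rfl)
        rw [siteTr_mul_right _ (mem_site.1 (hs hv)), siteTr_mul_left _ (mem_site.1 (hs hu)),
          T.tr_r p hp, mul_one]
        exact mul_mem hu hv
    | zero => simp [siteTr]
    | add x y _ _ hx hy => rw [siteTr_add]; exact add_mem hx hy
    | smul c x _ hx => rw [siteTr_smul]; exact (seg r 0 (p + 1)).smul_mem hx c

theorem iterTr_seg {p l : ℕ} (hp : p + l ≤ n) {x : B} (hx : x ∈ seg r 0 (p + l)) :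
    iterTr C e p l x ∈ seg r 0 p := by
  induction l generalizing x with
  | zero => exact hx
  | succ l ih => exact ih (by omega) (T.siteTr_seg (by omega) hx)

theorem iterTr_cyclic {x : B} (hx : x ∈ seg r 0 n) (y : B) :
    iterTr C e 0 n (x * y) = iterTr C e 0 n (y * x) := by
  induction hx using Algebra.adjoin_induction generalizing y with
  | mem x hx =>
    obtain ⟨i, -, hi, rfl⟩ := hx
    obtain ⟨l, rfl⟩ := Nat.exists_eq_add_of_le (show i + 2 ≤ n from hi)
    have hr : ∀ j, 0 + (i + 2) ≤ j → j < 0 + (i + 2) + l → r i ∈ site e j := fun j h1 h2 =>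
      T.r_mem_site hi (by omega) (by omega) (by omega)
    rw [iterTr_append, iterTr_append 0 (i + 2), iterTr_mul_left hr, iterTr_mul_right hr]
    simp only [iterTr, zero_add]
    rw [T.cyclic i hi]
  | algebraMap c => rw [← Algebra.commutes]
  | add x y _ _ hx hy => rw [add_mul, mul_add, iterTr_add, iterTr_add, hx, hy]
  | mul x y _ _ hx hy => rw [mul_assoc, hx, mul_assoc, hy, mul_assoc]

theorem ascProd_mem {a l p : ℕ} (hp : a + l + 1 ≤ p) : ascProd r a l ∈ seg r a p := by
  induction l with
  | zero => exact one_mem _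
  | succ l ih => exact mul_mem (ih (by omega)) (r_mem_seg (by omega) (by omega))

theorem descProd_mem {a l p : ℕ} (hp : a + l + 1 ≤ p) (hpn : p ≤ n) :
    descProd s a l ∈ seg r a p := by
  induction l with
  | zero => exact one_mem _
  | succ l ih =>
    exact mul_mem (T.s_mem (by omega) (r_mem_seg (by omega) (by omega))) (ih (by omega))

theorem ascProd_mul_descProd (a l : ℕ) : ascProd r a l * descProd s a l = 1 := by
  induction l with
  | zero => exact one_mul _
  | succ l ih =>
    rw [descProd, ascProd, mul_assoc, ← mul_assoc (r _), T.r_mul_s, one_mul, ih]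

/-- Shifting an element one site to the right does not change its iterated trace. -/
theorem iterTr_shift {p l : ℕ} (hp : p + l + 1 ≤ n) {x : B}
    (hx : ∀ j, p + l ≤ j → j < n → x ∈ site e j) :
    iterTr C e (p + 1) l (ascProd r p l * x * descProd s p l) = iterTr C e p l x := by
  induction l generalizing x with
  | zero => simp [iterTr, ascProd, descProd]
  | succ l ih =>
    have h1 : ascProd r p l ∈ site e (p + l + 1) :=
      T.seg_le_site (p := p + l + 1) (by omega) (by omega) (by omega) (T.ascProd_mem le_rfl)
    have h2 : descProd s p l ∈ site e (p + l + 1) :=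
      T.seg_le_site (p := p + l + 1) (by omega) (by omega) (by omega)
        (T.descProd_mem le_rfl (by omega))
    have h3 : ascProd r p (l + 1) * x * descProd s p (l + 1) =
        ascProd r p l * (r (p + l) * x * s (p + l)) * descProd s p l := by
      simp only [ascProd, descProd, mul_assoc]
    rw [h3, iterTr, show p + 1 + l = p + l + 1 by omega, siteTr_mul_right _ (mem_site.1 h2),
      siteTr_mul_left _ (mem_site.1 h1), T.siteTr_conj (by omega) (hx _ (by omega) (by omega)),
      ih (by omega) ?_, iterTr]
    intro j h4 h5
    by_cases hj : j = p + l
    · subst hj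
      exact T.siteTr_mem_site_self h5 x
    · exact T.siteTr_mem_site (by omega) h5 (hx j (by omega) h5)

theorem ascProd_mul_r {p l i : ℕ} (hp : p + l + 1 ≤ n) (h1 : p ≤ i) (h2 : i + 1 < p + l) :
    ascProd r p l * r i = r (i + 1) * ascProd r p l := by
  induction l with
  | zero => omega
  | succ l ih =>
    rw [ascProd]
    by_cases hi : i + 1 = p + l
    · obtain ⟨l, rfl⟩ : ∃ l', l = l' + 1 := ⟨l - 1, by omega⟩
      obtain rfl : i = p + l := by omega
      have hc : ascProd r p l * r (p + l + 1) = r (p + l + 1) * ascProd r p l :=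
        seg_commute (fun j _ hj => T.r_r_comm (by omega) (by omega) (by omega))
          (T.ascProd_mem (p := p + l + 1) le_rfl)
      calc _ = ascProd r p l * (r (p + l) * r (p + l + 1) * r (p + l)) := by
            simp only [ascProd, mul_assoc, add_assoc]
        _ = ascProd r p l * r (p + l + 1) * r (p + l) * r (p + l + 1) := by
            rw [T.braid _ (by omega)]; simp only [mul_assoc]
        _ = _ := by rw [hc]; simp only [ascProd, mul_assoc, add_assoc]
    · rw [mul_assoc, ← T.r_r_comm (by omega) (by omega) (by omega : i + 1 < p + l), ← mul_assoc,
        ih (by omega) (by omega), mul_assoc]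

section Copies

variable {X : B} (hX : ∀ j, 1 ≤ j → j < n → X ∈ site e j)
include hX

theorem conjCopy_mem_site {t j : ℕ} (h1 : t < j) (h2 : j < n) : conjCopy r s X t ∈ site e j := by
  induction t with
  | zero => exact hX j h1 h2
  | succ t ih =>
    have hr := T.r_mem_site (i := t) (j := j) (by omega) h2 (by omega) (by omega)
    exact mul_mem (mul_mem hr (ih (by omega))) (T.s_mem (by omega) hr)

theorem r_mul_conjCopy {i t : ℕ} (hi : i + 1 < n) (ht : t < n) (h1 : t ≠ i) (h2 : t ≠ i + 1) :
    r i * conjCopy r s X t = conjCopy r s X t * r i := by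
  by_cases hti : t < i
  · exact T.r_mul_comm hi (T.conjCopy_mem_site hX hti (by omega))
      (T.conjCopy_mem_site hX (by omega) hi)
  · obtain ⟨d, rfl⟩ := Nat.exists_eq_add_of_le (show i + 2 ≤ t by omega)
    clear hti h1 h2
    induction d with
    | zero =>
      set Y := conjCopy r s X i
      have hY : r (i + 1) * Y = Y * r (i + 1) :=
        T.r_mul_comm ht (T.conjCopy_mem_site hX (by omega) hi)
          (T.conjCopy_mem_site hX (by omega) ht)
      have hb := T.braid i ht
      have hs : r (i + 1) * s i * s (i + 1) = s i * s (i + 1) * r i := by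
        calc r (i + 1) * s i * s (i + 1) = s i * s (i + 1) * (r (i + 1) * r i * r (i + 1)) *
              s i * s (i + 1) := by
              rw [show s i * s (i + 1) * (r (i + 1) * r i * r (i + 1)) = s i *
                (s (i + 1) * r (i + 1)) * r i * r (i + 1) by simp only [mul_assoc], T.s_mul_r,
                mul_one, T.s_mul_r, one_mul]
          _ = s i * s (i + 1) * r i * (r (i + 1) * (r i * s i) * s (i + 1)) := by
              rw [← hb]; simp only [mul_assoc]
          _ = _ := by rw [T.r_mul_s, mul_one, T.r_mul_s, mul_one]
      change r i * (r (i + 1) * (r i * Y * s i) * s (i + 1)) =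
        r (i + 1) * (r i * Y * s i) * s (i + 1) * r i
      calc _ = r i * r (i + 1) * r i * Y * s i * s (i + 1) := by simp only [mul_assoc]
        _ = r (i + 1) * r i * (r (i + 1) * Y) * s i * s (i + 1) := by
            rw [hb]; simp only [mul_assoc]
        _ = r (i + 1) * r i * Y * (r (i + 1) * s i * s (i + 1)) := by
            rw [hY]; simp only [mul_assoc]
        _ = _ := by rw [hs]; simp only [mul_assoc]
    | succ d ih =>
      have hc := T.r_r_comm hi (j := i + 2 + d) (by omega) (by omega)
      have hc' := T.s_comm_of_r_comm hc.symm
      change r i * (r (i + 2 + d) * conjCopy r s X (i + 2 + d) * s (i + 2 + d)) =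
        r (i + 2 + d) * conjCopy r s X (i + 2 + d) * s (i + 2 + d) * r i
      rw [← mul_assoc, ← mul_assoc, hc, mul_assoc (r _) (r i), ih (by omega), mul_assoc _ _ (r i),
        hc']
      simp only [mul_assoc]

theorem seg_mul_conjCopy {a p t : ℕ} (hp : p ≤ n) (ht : t < n) (h : p ≤ t ∨ t < a) {x : B}
    (hx : x ∈ seg r a p) : x * conjCopy r s X t = conjCopy r s X t * x :=
  seg_commute (fun _ _ _ => T.r_mul_conjCopy hX (by omega) ht (by omega) (by omega)) hx

theorem ascProd_mul_conjCopy {p l i : ℕ} (hp : p + l + 1 ≤ n) (h1 : p ≤ i) (h2 : i < p + l) :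
    ascProd r p l * conjCopy r s X i = conjCopy r s X (i + 1) * ascProd r p l := by
  induction l with
  | zero => omega
  | succ l ih =>
    rw [ascProd]
    by_cases hi : i = p + l
    · subst hi
      have hc : r (p + l) * conjCopy r s X (p + l) = conjCopy r s X (p + l + 1) * r (p + l) := by
        rw [conjCopy, mul_assoc _ (s _), T.s_mul_r, mul_one]
      rw [mul_assoc, hc, ← mul_assoc, T.seg_mul_conjCopy hX (p := p + l + 1) (by omega) (by omega)
        (Or.inl le_rfl) (T.ascProd_mem le_rfl), mul_assoc]
    · rw [mul_assoc, T.r_mul_conjCopy hX (by omega) (by omega) (by omega) (by omega), ← mul_assoc,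
        ih (by omega) (by omega), mul_assoc]

theorem copyProd_mem_site {a l j : ℕ} (h1 : a + l ≤ j) (h2 : j < n) :
    copyProd r s X a l ∈ site e j := by
  induction l with
  | zero => exact one_mem _
  | succ l ih => exact mul_mem (ih (by omega)) (T.conjCopy_mem_site hX (by omega) h2)

theorem ascProd_mul_copyProd {p l t : ℕ} (hp : p + l + 1 ≤ n) (ht : t ≤ l) :
    ascProd r p l * copyProd r s X p t = copyProd r s X (p + 1) t * ascProd r p l := by
  induction t with
  | zero => simp [copyProd]
  | succ t ih =>
    rw [copyProd, copyProd, ← mul_assoc, ih (by omega), mul_assoc,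
      T.ascProd_mul_conjCopy hX hp (by omega) (by omega), show p + t + 1 = p + 1 + t by omega,
      mul_assoc]

theorem exists_copyProd_eq (p l : ℕ) (hp : p + l ≤ n) : ∃ u ∈ seg r 0 n, ∃ v ∈ seg r 0 n,
    copyProd r s X p l = u * copyProd r s X 0 l * v := by
  induction p with
  | zero => exact ⟨1, one_mem _, 1, one_mem _, by simp⟩
  | succ p ih =>
    obtain ⟨u, hu, v, hv, h⟩ := ih (by omega)
    have hle : seg r p n ≤ seg r 0 n := seg_mono (Nat.zero_le _) le_rfl
    refine ⟨ascProd r p l * u, mul_mem (hle (T.ascProd_mem (by omega))) hu,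
      v * descProd s p l, mul_mem hv (hle (T.descProd_mem (by omega) le_rfl)), ?_⟩
    calc copyProd r s X (p + 1) l =
          copyProd r s X (p + 1) l * ascProd r p l * descProd s p l := by
          rw [mul_assoc, T.ascProd_mul_descProd, mul_one]
      _ = _ := by
          rw [← T.ascProd_mul_copyProd hX (by omega) le_rfl, h]; simp only [mul_assoc]

theorem exists_shift (p l : ℕ) (hp : p + l ≤ n) {z : B} (hz : z ∈ seg r 0 l) :
    ∃ z' ∈ seg r p (p + l), iterTr C e p l (z' * copyProd r s X p l) =
      iterTr C e 0 l (z * copyProd r s X 0 l) := by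
  induction p with
  | zero => exact ⟨z, by rwa [zero_add], rfl⟩
  | succ p ih =>
    obtain ⟨z', hz', h⟩ := ih (by omega)
    have key : ∀ y ∈ seg r p (p + l), ∃ y' ∈ seg r (p + 1) (p + 1 + l),
        ascProd r p l * y = y' * ascProd r p l := by
      intro y hy
      induction hy using Algebra.adjoin_induction with
      | mem y hy =>
        obtain ⟨i, h1, h2, rfl⟩ := hy
        exact ⟨_, r_mem_seg (by omega) (by omega), T.ascProd_mul_r (by omega) h1 h2⟩
      | algebraMap c => exact ⟨_, Subalgebra.algebraMap_mem _ c, (Algebra.commutes _ _).symm⟩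
      | add x y _ _ hx hy =>
        obtain ⟨x', hx', h1⟩ := hx
        obtain ⟨y', hy', h2⟩ := hy
        exact ⟨_, add_mem hx' hy', by rw [mul_add, h1, h2, add_mul]⟩
      | mul x y _ _ hx hy =>
        obtain ⟨x', hx', h1⟩ := hx
        obtain ⟨y', hy', h2⟩ := hy
        exact ⟨_, mul_mem hx' hy', by rw [← mul_assoc, h1, mul_assoc, h2, mul_assoc]⟩
    obtain ⟨y, hy, hzy⟩ := key z' hz'
    refine ⟨y, hy, ?_⟩
    rw [← h, ← T.iterTr_shift (p := p) (l := l) (by omega)]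
    · congr 1
      rw [← mul_assoc, hzy, mul_assoc y, T.ascProd_mul_copyProd hX (by omega) le_rfl, mul_assoc,
        mul_assoc, T.ascProd_mul_descProd, mul_one]
    · intro j h1 h2
      exact mul_mem (T.seg_le_site (by omega) h2 (Or.inr h1) hz') (T.copyProd_mem_site hX h1 h2)

end Copies

end BraidTower

end BraidTower

section Reorder

variable {N n m : ℕ} {B : Type*} [Ring B] [Algebra ℂ B] {q : ℂ} {C : Matrix (Fin N) (Fin N) ℂ}
  {e : ℕ → Fin N → Fin N → B} {r s : ℕ → B} {X Y : B} {J : Submodule ℂ B}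

/-- The span of the products `u * X_{m+1} ⋯ X_{m+p} * h` with `u` braiding only the sites from `m`
on and `h` braiding all sites, enlarged by `J`. -/
def braidSpan (r s : ℕ → B) (X : B) (J : Submodule ℂ B) (n m p : ℕ) : Submodule ℂ B :=
  Submodule.span ℂ {y | ∃ u ∈ seg r m n, ∃ h ∈ seg r 0 n, y = u * copyProd r s X m p * h} ⊔ J

/-- A subspace that is a left ideal and is stable under right multiplication by the matrix units
and the braid generators. -/
structure StableIdeal (n : ℕ) (e : ℕ → Fin N → Fin N → B) (r : ℕ → B)
    (J : Submodule ℂ B) : Prop where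
  mul_mem : ∀ x, ∀ y ∈ J, x * y ∈ J
  mul_unit : ∀ y ∈ J, ∀ i, i < n → ∀ a b, y * e i a b ∈ J
  mul_r : ∀ y ∈ J, ∀ i, i + 1 < n → y * r i ∈ J

namespace StableIdeal

variable (hJ : StableIdeal n e r J)
include hJ

theorem mul_seg {y h : B} (hy : y ∈ J) (hh : h ∈ seg r 0 n) : y * h ∈ J := by
  induction hh using Algebra.adjoin_induction generalizing y with
  | mem x hx =>
    obtain ⟨i, -, hi, rfl⟩ := hx
    exact hJ.mul_r y hy i hi
  | algebraMap c =>
    rw [Algebra.algebraMap_eq_smul_one, mul_smul_comm, mul_one]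
    exact J.smul_mem _ hy
  | add x x' _ _ h1 h2 =>
    rw [mul_add]
    exact J.add_mem (h1 hy) (h2 hy)
  | mul x x' _ _ h1 h2 =>
    rw [← mul_assoc]
    exact h2 (h1 hy)

theorem iterTr_mem {a l : ℕ} (hl : a + l ≤ n) {y : B} (hy : y ∈ J) : iterTr C e a l y ∈ J := by
  induction l generalizing y with
  | zero => exact hy
  | succ l ih =>
    refine ih (by omega) (J.sum_mem fun a' _ => J.sum_mem fun b _ => J.sum_mem fun w _ =>
      J.smul_mem _ ?_)
    exact hJ.mul_unit _ (hJ.mul_mem _ _ hy) _ (by omega) _ _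

end StableIdeal

namespace BraidTower

variable (T : BraidTower n q C e r s)
include T

theorem iterTr_mem_site {a l j : ℕ} (hl : a + l ≤ n) (hj : j < n) {x : B}
    (hx : a ≤ j ∧ j < a + l ∨ x ∈ site e j) : iterTr C e a l x ∈ site e j := by
  induction l generalizing x with
  | zero => exact hx.resolve_left (by omega)
  | succ l ih =>
    apply ih (by omega)
    by_cases h : a ≤ j ∧ j < a + l
    · exact Or.inl h
    · refine Or.inr ?_
      by_cases hja : j = a + l
      · subst hja
        exact T.siteTr_mem_site_self hj x
      · exact T.siteTr_mem_site (by omega) hj (hx.resolve_left (by omega))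

section Permutation

variable (hX : ∀ j, 1 ≤ j → j < n → X ∈ site e j) (hY : ∀ j, 1 ≤ j → j < n → Y ∈ site e j)
  (hYX : 1 < n → Y * r 0 * X * r 0 = r 0 * X * s 0 * Y + r 0)

include hY hYX in
theorem exists_mul_conjCopy {t : ℕ} (h1 : 1 ≤ t) (ht : t < n) :
    ∃ h ∈ seg r 0 (t + 1), ∃ h' ∈ seg r 0 (t + 1),
      Y * conjCopy r s X t = conjCopy r s X t * Y * h + h' := by
  induction t, h1 using Nat.le_induction with
  | base =>
    have hs : s 0 ∈ seg r 0 2 := T.s_mem ht (r_mem_seg le_rfl (by omega))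
    refine ⟨s 0 * s 0, mul_mem hs hs, s 0, hs, ?_⟩
    have h2 : Y * (r 0 * X * s 0) = Y * r 0 * X * r 0 * (s 0 * s 0) := by
      simp only [mul_assoc]
      rw [← mul_assoc (r 0) (s 0), T.r_mul_s, one_mul]
    simp only [conjCopy]
    rw [h2, hYX ht, add_mul, ← mul_assoc (r 0) (s 0), T.r_mul_s, one_mul]
  | succ t h1 ih =>
    obtain ⟨h, hh, h', hh', he⟩ := ih (by omega)
    have hr : r t ∈ seg r 0 (t + 1 + 1) := r_mem_seg (Nat.zero_le _) (by omega)
    have hs := T.s_mem ht hr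
    have hle : seg r 0 (t + 1) ≤ seg r 0 (t + 1 + 1) := seg_mono le_rfl (by omega)
    have hYr : Y * r t = r t * Y :=
      (T.r_mul_comm ht (hY t h1 (by omega)) (hY _ (by omega) ht)).symm
    refine ⟨r t * h * s t, mul_mem (mul_mem hr (hle hh)) hs,
      r t * h' * s t, mul_mem (mul_mem hr (hle hh')) hs, ?_⟩
    calc Y * (r t * conjCopy r s X t * s t)
        = r t * (Y * conjCopy r s X t) * s t := by rw [← mul_assoc, ← mul_assoc, hYr]; noncomm_ring
      _ = r t * conjCopy r s X t * Y * h * s t + r t * h' * s t := by rw [he]; noncomm_ring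
      _ = r t * conjCopy r s X t * (s t * r t) * Y * h * s t + r t * h' * s t := by
          rw [T.s_mul_r, mul_one]
      _ = r t * conjCopy r s X t * s t * (r t * Y) * h * s t + r t * h' * s t := by noncomm_ring
      _ = _ := by rw [← hYr]; simp only [conjCopy]; noncomm_ring

include hX in
theorem r_mul_copyProd {i l : ℕ} (hi : i + 1 < n) (hl : m + l ≤ n) (h : i + 1 < m ∨ m + l ≤ i) :
    r i * copyProd r s X m l = copyProd r s X m l * r i := by
  induction l with
  | zero => simp [copyProd]
  | succ l ih =>
    rw [copyProd, ← mul_assoc, ih (by omega) (by omega), mul_assoc,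
      T.r_mul_conjCopy hX hi (by omega) (by omega) (by omega), mul_assoc]

include hX hY hYX in
theorem exists_mul_copyProd (hm : 1 ≤ m) {l : ℕ} (hl : m + l ≤ n) :
    ∃ h ∈ seg r 0 (m + l), Y * copyProd r s X m l - copyProd r s X m l * Y * h ∈
      Submodule.span ℂ {y | ∃ p, l = p + 1 ∧ ∃ u ∈ seg r m n, ∃ h ∈ seg r 0 (m + l),
        y = u * copyProd r s X m p * h} := by
  induction l with
  | zero => exact ⟨1, one_mem _, by simp [copyProd]⟩
  | succ l ih =>
    obtain ⟨h, hh, hd⟩ := ih (by omega)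
    obtain ⟨h1, hh1, h1', hh1', he⟩ :=
      T.exists_mul_conjCopy hY hYX (X := X) (t := m + l) (by omega) (by omega)
    have hle : seg r 0 (m + l) ≤ seg r 0 (m + l + 1) := seg_mono le_rfl (by omega)
    refine ⟨h1 * h, mul_mem hh1 (hle hh), ?_⟩
    have hc := T.seg_mul_conjCopy hX (t := m + l) (p := m + l) (by omega) (by omega)
      (Or.inl le_rfl) hh
    have hsplit : Y * copyProd r s X m (l + 1) - copyProd r s X m (l + 1) * Y * (h1 * h) =
        (Y * copyProd r s X m l - copyProd r s X m l * Y * h) * conjCopy r s X (m + l) +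
          1 * copyProd r s X m l * (h1' * h) := by
      calc _ = (Y * copyProd r s X m l - copyProd r s X m l * Y * h) * conjCopy r s X (m + l) +
          (copyProd r s X m l * Y * (h * conjCopy r s X (m + l)) -
            copyProd r s X m l * conjCopy r s X (m + l) * Y * h1 * h) := by
            rw [copyProd]; noncomm_ring
        _ = (Y * copyProd r s X m l - copyProd r s X m l * Y * h) * conjCopy r s X (m + l) +
          copyProd r s X m l * ((Y * conjCopy r s X (m + l)) -
            conjCopy r s X (m + l) * Y * h1) * h := by
            rw [hc]; noncomm_ring
        _ = _ := by rw [he]; noncomm_ring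
    rw [hsplit]
    refine Submodule.add_mem _ ?_ (Submodule.subset_span
      ⟨l, rfl, 1, one_mem _, _, mul_mem hh1' (hle hh), rfl⟩)
    generalize Y * copyProd r s X m l - copyProd r s X m l * Y * h = d at hd
    induction hd using Submodule.span_induction with
    | mem x hx =>
      obtain ⟨p, rfl, u, hu, h2, hh2, rfl⟩ := hx
      have hr : r (m + p) ∈ seg r m (m + (p + 1) + 1) := r_mem_seg (by omega) (by omega)
      have hs := T.s_mem (by omega) hr
      have hle' : seg r m (m + (p + 1) + 1) ≤ seg r 0 (m + (p + 1) + 1) :=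
        seg_mono (Nat.zero_le _) le_rfl
      refine Submodule.subset_span ⟨p + 1, rfl, u * r (m + p),
        mul_mem hu (r_mem_seg (by omega) (by omega)), s (m + p) * h2,
        mul_mem (hle' hs) (hle hh2), ?_⟩
      rw [mul_assoc (u * _) h2, T.seg_mul_conjCopy hX (by omega) (by omega) (Or.inl le_rfl) hh2,
        show m + (p + 1) = m + p + 1 by omega, conjCopy, copyProd]
      have := T.r_mul_copyProd hX (m := m) (i := m + p) (l := p) (by omega) (by omega)
        (Or.inr le_rfl)
      calc _ = u * (copyProd r s X m p * r (m + p)) * conjCopy r s X (m + p) * s (m + p) * h2 := by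
            noncomm_ring
        _ = _ := by rw [← this]; noncomm_ring
    | zero => simp
    | add x y _ _ hx hy => rw [add_mul]; exact Submodule.add_mem _ hx hy
    | smul c x _ hx => rw [smul_mul_assoc]; exact Submodule.smul_mem _ _ hx

section Ideal

variable (hJ : StableIdeal n e r J) (hYJ : Y ∈ J)
include hJ

omit T in
theorem mul_braidSpan {p : ℕ} {J' : Submodule ℂ B} {y x : B} (hJ' : J ≤ J')
    (h : ∀ u ∈ seg r m n, ∀ h ∈ seg r 0 n, y * (u * copyProd r s X m p * h) ∈ J')
    (hx : x ∈ braidSpan r s X J n m p) : y * x ∈ J' := by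
  have : braidSpan r s X J n m p ≤ J'.comap (LinearMap.mulLeft ℂ y) := by
    refine sup_le (Submodule.span_le.2 ?_) fun z hz => hJ' (hJ.mul_mem _ _ hz)
    rintro _ ⟨u, hu, h2, hh2, rfl⟩
    exact h u hu h2 hh2
  exact this hx

omit T in
theorem braidSpan_mul {p : ℕ} {x u v : B} (hu : u ∈ seg r m n) (hv : v ∈ seg r 0 n)
    (hx : x ∈ braidSpan r s X J n m p) : u * x * v ∈ braidSpan r s X J n m p := by
  have : braidSpan r s X J n m p ≤ (braidSpan r s X J n m p).comap
      (LinearMap.mulRight ℂ v ∘ₗ LinearMap.mulLeft ℂ u) := by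
    refine sup_le (Submodule.span_le.2 ?_) fun z hz =>
      Submodule.mem_sup_right (hJ.mul_seg (hJ.mul_mem _ _ hz) hv)
    rintro _ ⟨u', hu', h2, hh2, rfl⟩
    refine Submodule.mem_sup_left (Submodule.subset_span
      ⟨u * u', mul_mem hu hu', h2 * v, mul_mem hh2 hv, ?_⟩)
    simp [mul_assoc]
  exact this hx

include hYJ in
theorem conjCopy_mem {t : ℕ} (ht : t < n) : conjCopy r s Y t ∈ J := by
  induction t with
  | zero => exact hYJ
  | succ t ih =>
    exact hJ.mul_seg (hJ.mul_mem _ _ (ih (by omega)))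
      (T.s_mem ht (r_mem_seg (Nat.zero_le _) (by omega)))

include hX hY hYX hYJ in
theorem conjCopy_mul_copyProd {p t : ℕ} (ht : t < m) (hp : m + (p + 1) ≤ n) :
    conjCopy r s Y t * copyProd r s X m (p + 1) ∈ braidSpan r s X J n m p := by
  induction t with
  | zero =>
    obtain ⟨h, hh, hd⟩ := T.exists_mul_copyProd hX hY hYX (by omega) hp
    rw [← sub_add_cancel (conjCopy r s Y 0 * copyProd r s X m (p + 1))
      (copyProd r s X m (p + 1) * Y * h)]
    refine Submodule.add_mem _ (Submodule.mem_sup_left (Submodule.span_mono ?_ hd))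
      (Submodule.mem_sup_right (hJ.mul_seg (hJ.mul_mem _ _ hYJ) (seg_mono le_rfl hp hh)))
    rintro _ ⟨p', h1, u, hu, h2, hh2, rfl⟩
    obtain rfl : p = p' := by omega
    exact ⟨u, hu, h2, seg_mono le_rfl hp hh2, rfl⟩
  | succ t ih =>
    have hr : r t ∈ seg r 0 n := r_mem_seg (Nat.zero_le _) (by omega)
    have hs := T.s_mem (by omega) hr
    have hc : s t * copyProd r s X m (p + 1) = copyProd r s X m (p + 1) * s t :=
      T.s_comm_of_r_comm (T.r_mul_copyProd hX (by omega) hp (Or.inl ht))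
    have hc' : r t * copyProd r s X m p = copyProd r s X m p * r t :=
      T.r_mul_copyProd hX (by omega) (by omega) (Or.inl ht)
    have : conjCopy r s Y (t + 1) * copyProd r s X m (p + 1) =
        r t * (1 * (conjCopy r s Y t * copyProd r s X m (p + 1)) * s t) := by
      rw [conjCopy, mul_assoc _ (s t), hc]; noncomm_ring
    rw [this]
    refine mul_braidSpan hJ le_sup_right (fun u hu h hh => ?_)
      (braidSpan_mul hJ (one_mem _) hs (ih (by omega)))
    refine Submodule.mem_sup_left (Submodule.subset_span ⟨u, hu, r t * h, mul_mem hr hh, ?_⟩)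
    have hru : r t * u = u * r t :=
      (seg_commute (fun i h1 h2 => (T.r_r_comm (by omega) (by omega) (by omega)).symm) hu).symm
    calc _ = (r t * u) * copyProd r s X m p * h := by noncomm_ring
      _ = u * (r t * copyProd r s X m p) * h := by rw [hru]; noncomm_ring
      _ = _ := by rw [hc']; noncomm_ring

include hX hY hYX hYJ in
theorem conjCopy_mul_braidSpan {p t : ℕ} (ht : t < m) (hp : m + (p + 1) ≤ n) {x : B}
    (hx : x ∈ braidSpan r s X J n m (p + 1)) :
    conjCopy r s Y t * x ∈ braidSpan r s X J n m p := by
  refine mul_braidSpan hJ le_sup_right (fun u hu h hh => ?_) hx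
  rw [← mul_assoc, ← mul_assoc, ← T.seg_mul_conjCopy hY le_rfl (by omega) (Or.inr ht) hu,
    mul_assoc u]
  exact braidSpan_mul hJ hu hh (T.conjCopy_mul_copyProd hX hY hYX hJ hYJ ht hp)

include hY hYJ in
theorem conjCopy_mul_braidSpan_zero {t : ℕ} (ht : t < m) (hm : m ≤ n) {x : B}
    (hx : x ∈ braidSpan r s X J n m 0) : conjCopy r s Y t * x ∈ J := by
  refine mul_braidSpan hJ le_rfl (fun u hu h hh => ?_) hx
  rw [← mul_assoc, ← mul_assoc, ← T.seg_mul_conjCopy hY le_rfl (by omega) (Or.inr ht) hu,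
    copyProd, mul_one]
  exact hJ.mul_seg (hJ.mul_mem _ _ (T.conjCopy_mem hJ hYJ (by omega))) hh

include hX hY hYX hYJ in
theorem copyProd_mul_braidSpan {j p : ℕ} (hj : j ≤ m) (hp : m + (p + j) ≤ n) {x : B}
    (hx : x ∈ braidSpan r s X J n m (p + j)) :
    copyProd r s Y 0 j * x ∈ braidSpan r s X J n m p := by
  induction j generalizing x with
  | zero => simpa [copyProd] using hx
  | succ j ih =>
    rw [copyProd, mul_assoc, zero_add]
    exact ih (by omega) (by omega) (T.conjCopy_mul_braidSpan hX hY hYX hJ hYJ (by omega) hp hx)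

include hX hY hYX hYJ in
theorem copyProd_mul_braidSpan_of_lt {j p : ℕ} (hj : j ≤ m) (hp : m + p ≤ n) (hpj : p < j) {x : B}
    (hx : x ∈ braidSpan r s X J n m p) : copyProd r s Y 0 j * x ∈ J := by
  induction j generalizing p x with
  | zero => omega
  | succ j ih =>
    rw [copyProd, mul_assoc, zero_add]
    cases p with
    | zero =>
      exact hJ.mul_mem _ _ (T.conjCopy_mul_braidSpan_zero hY hJ hYJ (by omega) (by omega) hx)
    | succ p =>
      exact ih (by omega) (by omega) (by omega)
        (T.conjCopy_mul_braidSpan hX hY hYX hJ hYJ (by omega) hp hx)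

include hX in
/-- The full trace of a braided product of copies is a trace over the first sites only. -/
theorem exists_iterTr_eq {p : ℕ} (hp : m + p ≤ n) {x : B}
    (hx : x ∈ braidSpan r s X J n m p) :
    ∃ z ∈ seg r 0 p, iterTr C e 0 n x - iterTr C e 0 p (z * copyProd r s X 0 p) ∈ J := by
  obtain ⟨u, hu, v, hv, he⟩ := T.exists_copyProd_eq hX m p hp
  have hle : seg r m n ≤ seg r 0 n := seg_mono (Nat.zero_le _) le_rfl
  obtain ⟨y, hy, z, hz, rfl⟩ := Submodule.mem_sup.1 hx
  have hz' : iterTr C e 0 n z ∈ J := hJ.iterTr_mem (by omega) hz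
  suffices h : ∃ w ∈ seg r 0 p,
      iterTr C e 0 n y = iterTr C e 0 p (w * copyProd r s X 0 p) by
    obtain ⟨w, hw, h⟩ := h
    refine ⟨w, hw, ?_⟩
    rwa [iterTr_add, h, add_sub_cancel_left]
  clear hx hz hz'
  induction hy using Submodule.span_induction with
  | mem x hx =>
    obtain ⟨u', hu', h, hh, rfl⟩ := hx
    have h1 : u' * u ∈ seg r 0 n := mul_mem (hle hu') hu
    have h2 : v * h * (u' * u) ∈ seg r 0 n := mul_mem (mul_mem hv hh) h1
    obtain ⟨l, rfl⟩ := Nat.exists_eq_add_of_le (show p ≤ n by omega)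
    refine ⟨iterTr C e p l (v * h * (u' * u)), T.iterTr_seg le_rfl h2, ?_⟩
    calc _ = iterTr C e 0 (p + l) (u' * u * (copyProd r s X 0 p * (v * h))) := by
          rw [he]; congr 1; noncomm_ring
      _ = iterTr C e 0 (p + l) (v * h * (u' * u) * copyProd r s X 0 p) := by
          rw [T.iterTr_cyclic h1, mul_assoc, T.iterTr_cyclic h2]
      _ = _ := by
          rw [iterTr_append, zero_add, iterTr_mul_right]
          exact fun j h1 h2 => T.copyProd_mem_site hX (by omega) (by omega)
  | zero => exact ⟨0, zero_mem _, by
      rw [zero_mul, ← zero_smul ℂ (0 : B), iterTr_smul, iterTr_smul, zero_smul, zero_smul]⟩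
  | add x y _ _ hx hy =>
    obtain ⟨w, hw, h⟩ := hx
    obtain ⟨w', hw', h'⟩ := hy
    exact ⟨w + w', add_mem hw hw', by rw [iterTr_add, h, h', add_mul, iterTr_add]⟩
  | smul c x _ hx =>
    obtain ⟨w, hw, h⟩ := hx
    exact ⟨c • w, Subalgebra.smul_mem _ hw _, by rw [iterTr_smul, h, smul_mul_assoc, iterTr_smul]⟩

end Ideal

include hX hY in
/-- A product of two traces is a single trace over all sites. -/
theorem exists_iterTr_mul_iterTr {k : ℕ} (hn : n = m + k) {z w : B} (hz : z ∈ seg r 0 m)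
    (hw : w ∈ seg r 0 k) : ∃ w' ∈ seg r m n,
      iterTr C e 0 m (z * copyProd r s Y 0 m) * iterTr C e 0 k (w * copyProd r s X 0 k) =
        iterTr C e 0 n (z * (copyProd r s Y 0 m * (w' * copyProd r s X m k * 1))) := by
  subst hn
  obtain ⟨w', hw', h⟩ := T.exists_shift hX m k le_rfl hw
  refine ⟨w', hw', ?_⟩
  have hc : ∀ j, 0 ≤ j → j < 0 + m →
      iterTr C e 0 k (w * copyProd r s X 0 k) ∈ site e j := fun j _ h2 =>
    T.iterTr_mem_site (by omega) (by omega) ((lt_or_ge j k).imp (by omega) fun h =>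
      mul_mem (T.seg_le_site (by omega) (by omega) (Or.inr h) hw)
        (T.copyProd_mem_site hX (by omega) (by omega)))
  rw [← iterTr_mul_right hc, iterTr_append, mul_one, ← mul_assoc, zero_add,
    iterTr_mul_left (a := m), h]
  exact fun j h1 h2 => mul_mem (T.seg_le_site (by omega) h2 (Or.inr h1) hz)
    (T.copyProd_mem_site hY (by omega) h2)

variable (hJ : StableIdeal n e r J) (hYJ : Y ∈ J)
include hX hY hYX hJ hYJ

theorem exists_iterTr_mul_sub_mem {k : ℕ} (hn : n = m + k) {z w : B} (hz : z ∈ seg r 0 m)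
    (hw : w ∈ seg r 0 k) (hmk : m ≤ k) : ∃ v ∈ seg r 0 (k - m),
      iterTr C e 0 m (z * copyProd r s Y 0 m) * iterTr C e 0 k (w * copyProd r s X 0 k) -
        iterTr C e 0 (k - m) (v * copyProd r s X 0 (k - m)) ∈ J := by
  obtain ⟨w', hw', h⟩ := T.exists_iterTr_mul_iterTr hX hY hn hz hw
  obtain ⟨p, rfl⟩ := Nat.exists_eq_add_of_le' hmk
  have h1 := T.copyProd_mul_braidSpan hX hY hYX hJ hYJ (m := m) (j := m) (p := p) le_rfl
    (by omega) (Submodule.mem_sup_left (Submodule.subset_span ⟨w', hw', 1, one_mem _, rfl⟩))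
  have h2 := braidSpan_mul hJ (one_mem _)
    (seg_mono (le_refl 0) (show m ≤ n by omega) hz) h1
  obtain ⟨v, hv, hd⟩ := T.exists_iterTr_eq hX hJ (by omega) h2
  refine ⟨v, by rwa [Nat.add_sub_cancel], ?_⟩
  rwa [h, T.iterTr_cyclic (seg_mono le_rfl (by omega) hz), Nat.add_sub_cancel,
    ← one_mul (copyProd r s Y 0 m * _)]

theorem iterTr_mul_mem {k : ℕ} (hn : n = m + k) {z w : B} (hz : z ∈ seg r 0 m)
    (hw : w ∈ seg r 0 k) (hmk : k < m) :
      iterTr C e 0 m (z * copyProd r s Y 0 m) * iterTr C e 0 k (w * copyProd r s X 0 k) ∈ J := by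
  obtain ⟨w', hw', h⟩ := T.exists_iterTr_mul_iterTr hX hY hn hz hw
  rw [h]
  refine hJ.iterTr_mem (by omega) (hJ.mul_mem _ _ ?_)
  exact T.copyProd_mul_braidSpan_of_lt hX hY hYX hJ hYJ (m := m) (j := m) (p := k) le_rfl
    (by omega) hmk (Submodule.mem_sup_left (Submodule.subset_span ⟨w', hw', 1, one_mem _, rfl⟩))

end Permutation
end BraidTower
end Reorder

section MatrixSites

variable {α : Type*} [Ring α] {N n : ℕ}

theorem matAt_apply {i : ℕ} (hi : i < n) (X : Matrix (Fin N) (Fin N) α) (a b : Fin n → Fin N) :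
    matAt N n X i a b =
      if ∀ l : Fin n, (l : ℕ) ≠ i → a l = b l then X (a ⟨i, hi⟩) (b ⟨i, hi⟩) else 0 := by
  rw [matAt, dif_pos hi]; rfl

theorem opAt_apply {i : ℕ} (hi : i + 1 < n) (R : Matrix (Fin N × Fin N) (Fin N × Fin N) α)
    (a b : Fin n → Fin N) :
    opAt N n R i a b = if ∀ l : Fin n, (l : ℕ) ≠ i → (l : ℕ) ≠ i + 1 → a l = b l then
        R (a ⟨i, by omega⟩, a ⟨i + 1, hi⟩) (b ⟨i, by omega⟩, b ⟨i + 1, hi⟩) else 0 := by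
  rw [opAt, dif_pos hi]; rfl

theorem matAt_mul_apply {i : ℕ} (hi : i < n) (X : Matrix (Fin N) (Fin N) α)
    (Y : Matrix (Fin n → Fin N) (Fin n → Fin N) α) (a b : Fin n → Fin N) :
    (matAt N n X i * Y) a b =
      ∑ u, X (a ⟨i, hi⟩) u * Y (Function.update a ⟨i, hi⟩ u) b := by
  rw [Matrix.mul_apply]
  refine (Fintype.sum_of_injective (fun u => Function.update a ⟨i, hi⟩ u)
    (Function.update_injective a _) _ _ (fun c hc => ?_) fun u => ?_).symm
  · rw [matAt_apply hi, if_neg, zero_mul]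
    intro h
    refine hc ⟨c ⟨i, hi⟩, ?_⟩
    funext l
    by_cases hl : (l : ℕ) = i
    · obtain rfl : l = ⟨i, hi⟩ := Fin.ext hl
      simp
    · beta_reduce
      rw [Function.update_of_ne (by simpa [Fin.ext_iff] using hl), h l hl]
  · rw [matAt_apply hi, if_pos, Function.update_self]
    intro l hl
    rw [Function.update_of_ne (by simpa [Fin.ext_iff] using hl)]

theorem mul_matAt_apply {i : ℕ} (hi : i < n) (X : Matrix (Fin N) (Fin N) α)
    (Y : Matrix (Fin n → Fin N) (Fin n → Fin N) α) (a b : Fin n → Fin N) :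
    (Y * matAt N n X i) a b =
      ∑ u, Y a (Function.update b ⟨i, hi⟩ u) * X u (b ⟨i, hi⟩) := by
  rw [Matrix.mul_apply]
  refine (Fintype.sum_of_injective (fun u => Function.update b ⟨i, hi⟩ u)
    (Function.update_injective b _) _ _ (fun c hc => ?_) fun u => ?_).symm
  · rw [matAt_apply hi, if_neg, mul_zero]
    intro h
    refine hc ⟨c ⟨i, hi⟩, ?_⟩
    funext l
    by_cases hl : (l : ℕ) = i
    · obtain rfl : l = ⟨i, hi⟩ := Fin.ext hl
      simp
    · beta_reduce
      rw [Function.update_of_ne (by simpa [Fin.ext_iff] using hl), ← h l hl]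
  · rw [matAt_apply hi, if_pos, Function.update_self]
    intro l hl
    rw [Function.update_of_ne (by simpa [Fin.ext_iff] using hl)]

theorem matAt_mul_matAt_apply {i j : ℕ} (hi : i < n) (hj : j < n) (hij : i ≠ j)
    (X Y : Matrix (Fin N) (Fin N) α) (a b : Fin n → Fin N) :
    (matAt N n X i * matAt N n Y j) a b =
      if ∀ l : Fin n, (l : ℕ) ≠ i → (l : ℕ) ≠ j → a l = b l then
        X (a ⟨i, hi⟩) (b ⟨i, hi⟩) * Y (a ⟨j, hj⟩) (b ⟨j, hj⟩) else 0 := by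
  rw [matAt_mul_apply hi, Finset.sum_eq_single (b ⟨i, hi⟩)]
  · rw [matAt_apply hj, Function.update_of_ne (by simpa [Fin.ext_iff] using hij.symm), mul_ite,
      mul_zero]
    refine if_congr (forall_congr' fun l => ?_) rfl rfl
    by_cases hl : (l : ℕ) = i
    · obtain rfl : l = ⟨i, hi⟩ := Fin.ext hl
      simp
    · rw [Function.update_of_ne (by simpa [Fin.ext_iff] using hl)]
      simp [hl]
  · intro u _ hu
    rw [matAt_apply hj, if_neg, mul_zero]
    intro h
    have := h ⟨i, hi⟩ hij
    rw [Function.update_self] at this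
    exact hu this
  · simp

theorem matAt_mul_matAt_comm {i j : ℕ} (hi : i < n) (hj : j < n) (hij : i ≠ j)
    {X Y : Matrix (Fin N) (Fin N) α} (h : ∀ a b c d, X a b * Y c d = Y c d * X a b) :
    matAt N n X i * matAt N n Y j = matAt N n Y j * matAt N n X i := by
  ext a b
  rw [matAt_mul_matAt_apply hi hj hij, matAt_mul_matAt_apply hj hi hij.symm, h]
  exact if_congr (forall_congr' fun l => by tauto) rfl rfl

theorem matAt_mul_matAt {i : ℕ} (hi : i < n) (X Y : Matrix (Fin N) (Fin N) α) :
    matAt N n X i * matAt N n Y i = matAt N n (X * Y) i := by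
  ext a b
  have h : ∀ u, (∀ l : Fin n, (l : ℕ) ≠ i → Function.update a ⟨i, hi⟩ u l = b l) ↔
      ∀ l : Fin n, (l : ℕ) ≠ i → a l = b l := fun u =>
    forall_congr' fun l => imp_congr_right fun hl => by
      rw [Function.update_of_ne (by simpa [Fin.ext_iff] using hl)]
  simp only [matAt_mul_apply hi, matAt_apply hi, Function.update_self, mul_ite, mul_zero,
    Matrix.mul_apply, h]
  split_ifs <;> simp

theorem matAt_one (i : ℕ) : matAt N n (1 : Matrix (Fin N) (Fin N) α) i = 1 := by
  by_cases hi : i < n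
  · ext a b
    rw [matAt_apply hi, Matrix.one_apply, Matrix.one_apply, ← ite_and]
    refine if_congr ⟨fun h => ?_, by rintro rfl; simp⟩ rfl rfl
    ext l
    by_cases hl : (l : ℕ) = i
    · obtain rfl : l = ⟨i, hi⟩ := Fin.ext hl
      rw [h.2]
    · rw [h.1 l hl]
  · rw [matAt, dif_neg hi]

/-- The matrix units at the site `i`. -/
def siteUnit (α : Type*) [Ring α] (N n i : ℕ) (a b : Fin N) :
    Matrix (Fin n → Fin N) (Fin n → Fin N) α :=
  matAt N n (Matrix.single a b 1) i

theorem matUnits_siteUnit [Algebra ℂ α] {i : ℕ} (hi : i < n) : MatUnits (siteUnit α N n i) where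
  mul a b c d := by
    rw [siteUnit, siteUnit, matAt_mul_matAt hi]
    split_ifs with h
    · subst h
      simp [siteUnit]
    · rw [Matrix.single_mul_single_of_ne _ _ _ _ h]
      ext a b
      simp [matAt_apply hi]
  sum := by
    rw [← matAt_one (n := n) i, ← Matrix.sum_single_one]
    ext a b
    simp [siteUnit, matAt_apply hi, Matrix.sum_apply]

theorem siteUnit_mul_matAt {i j : ℕ} (hi : i < n) (hj : j < n) (hij : i ≠ j) (a b : Fin N)
    (X : Matrix (Fin N) (Fin N) α) :
    siteUnit α N n i a b * matAt N n X j = matAt N n X j * siteUnit α N n i a b :=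
  matAt_mul_matAt_comm hi hj hij fun c d _ _ => by
    rw [Matrix.single_apply]; split_ifs <;> simp

theorem siteUnit_comm {i j : ℕ} (hi : i < n) (hj : j < n) (hij : i ≠ j) (a b c d : Fin N) :
    siteUnit α N n i a b * siteUnit α N n j c d = siteUnit α N n j c d * siteUnit α N n i a b :=
  siteUnit_mul_matAt hi hj hij a b _

theorem matRep_siteUnit [Algebra ℂ α] {i : ℕ} (hi : i < n) (X : Matrix (Fin N) (Fin N) ℂ) :
    matRep (siteUnit α N n i) X = matAt N n (toA α X) i := by
  ext a b
  simp [matRep, Matrix.sum_apply, siteUnit, matAt_apply hi, toA, Matrix.single_apply, ite_and,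
    Algebra.algebraMap_eq_smul_one]

theorem matRep_prodUnits_siteUnit [Algebra ℂ α] {i : ℕ} (hi : i + 1 < n)
    (R : Matrix (Fin N × Fin N) (Fin N × Fin N) ℂ) :
    matRep (prodUnits (siteUnit α N n i) (siteUnit α N n (i + 1))) R = opAt N n (toA α R) i := by
  ext a b
  have hi' : i < n := by omega
  simp [matRep, Matrix.sum_apply, siteUnit, prodUnits, matAt_mul_matAt_apply hi' hi, toA,
    Matrix.single_apply, ite_and, Algebra.algebraMap_eq_smul_one, Fintype.sum_prod_type,
    opAt_apply hi]

theorem opAt_mul_opAt [Algebra ℂ α] {R S : Matrix (Fin N × Fin N) (Fin N × Fin N) ℂ}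
    (h : R * S = 1) (i : ℕ) : opAt N n (toA α R) i * opAt N n (toA α S) i = 1 := by
  by_cases hi : i + 1 < n
  · have hu := (matUnits_siteUnit (α := α) (N := N) (i := i) (n := n) (by omega)).prod
      (matUnits_siteUnit hi) (siteUnit_comm (by omega) hi (by omega))
    rw [← matRep_prodUnits_siteUnit hi, ← matRep_prodUnits_siteUnit hi, ← hu.matRep_mul, h,
      hu.matRep_one]
  · rw [opAt, opAt, dif_neg hi, dif_neg hi, one_mul]

end MatrixSites

section Embedding

variable {α : Type*} [Ring α] {N n p i : ℕ}

/-- The function equal to `u` at the places `i, …, i + p - 1` and to `a` elsewhere. -/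
def glue (p i : ℕ) (a : Fin n → Fin N) (u : Fin p → Fin N) : Fin n → Fin N :=
  fun l => if h : i ≤ l ∧ (l : ℕ) < i + p then u ⟨l - i, by omega⟩ else a l

/-- The inclusion of `p` places as the places `i, …, i + p - 1`. -/
def place (h : i + p ≤ n) (l : Fin p) : Fin n := ⟨i + l, by omega⟩

theorem glue_place (h : i + p ≤ n) (a : Fin n → Fin N) (u : Fin p → Fin N) :
    glue p i a u ∘ place h = u := by
  funext l
  simp [glue, place]

theorem forall_glue_left (a b : Fin n → Fin N) (u : Fin p → Fin N) :
    (∀ l : Fin n, ((l : ℕ) < i ∨ i + p ≤ l) → glue p i a u l = b l) ↔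
      ∀ l : Fin n, ((l : ℕ) < i ∨ i + p ≤ l) → a l = b l :=
  forall_congr' fun l => imp_congr_right fun hl => by
    rw [glue, dif_neg (by omega)]

/-- The embedding of operators on `p` sites as operators on the sites `i, …, i + p - 1`. -/
def embed (α : Type*) [Ring α] (N : ℕ) (h : i + p ≤ n)
    (X : Matrix (Fin p → Fin N) (Fin p → Fin N) α) :
    Matrix (Fin n → Fin N) (Fin n → Fin N) α :=
  Matrix.of fun a b => if ∀ l : Fin n, ((l : ℕ) < i ∨ i + p ≤ l) → a l = b l then
    X (a ∘ place h) (b ∘ place h) else 0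

theorem embed_apply (h : i + p ≤ n) (X : Matrix (Fin p → Fin N) (Fin p → Fin N) α)
    (a b : Fin n → Fin N) : embed α N h X a b =
      if ∀ l : Fin n, ((l : ℕ) < i ∨ i + p ≤ l) → a l = b l then
        X (a ∘ place h) (b ∘ place h) else 0 := rfl

theorem embed_mul (h : i + p ≤ n) (X Y : Matrix (Fin p → Fin N) (Fin p → Fin N) α) :
    embed α N h (X * Y) = embed α N h X * embed α N h Y := by
  ext a b
  have hsum : (embed α N h X * embed α N h Y) a b =
      ∑ u, embed α N h X a (glue p i a u) * embed α N h Y (glue p i a u) b := by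
    rw [Matrix.mul_apply]
    refine (Fintype.sum_of_injective (fun u => glue p i a u) (fun u v huv => ?_) _ _
      (fun c hc => ?_) fun u => rfl).symm
    · rw [← glue_place h a u, ← glue_place h a v]
      exact congrArg (· ∘ place h) huv
    · rw [embed_apply, if_neg, zero_mul]
      refine fun h2 => hc ⟨c ∘ place h, ?_⟩
      funext l
      by_cases hl : i ≤ l ∧ (l : ℕ) < i + p
      · simp only [glue, dif_pos hl, Function.comp_apply, place]
        congr 1
        exact Fin.ext (Nat.add_sub_cancel' hl.1)
      · simp only [glue, dif_neg hl]
        exact h2 l (by omega)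
  have hrefl : ∀ u : Fin p → Fin N, ∀ l : Fin n, ((l : ℕ) < i ∨ i + p ≤ l) →
      a l = glue p i a u l := fun u l hl => by rw [glue, dif_neg (by omega)]
  rw [hsum]
  simp only [embed_apply, forall_glue_left, glue_place, if_pos (hrefl _), Matrix.mul_apply]
  split_ifs <;> simp

theorem embed_diagonal (h : i + p ≤ n) (c : α) :
    embed α N h (Matrix.diagonal fun _ => c) = Matrix.diagonal fun _ => c := by
  ext a b
  rw [embed_apply, Matrix.diagonal_apply, Matrix.diagonal_apply, ← ite_and]
  refine if_congr ⟨fun h2 => ?_, by rintro rfl; simp⟩ rfl rfl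
  funext l
  by_cases hl : i ≤ l ∧ (l : ℕ) < i + p
  · have := congrFun h2.2 ⟨l - i, by omega⟩
    simp only [Function.comp_apply, place] at this
    rwa [show (⟨i + ((l : ℕ) - i), by omega⟩ : Fin n) = l from
      Fin.ext (Nat.add_sub_cancel' hl.1)] at this
  · exact h2.1 l (by omega)

/-- `embed` as a homomorphism of algebras. -/
def embedHom (α : Type*) [Ring α] [Algebra ℂ α] (N : ℕ) (h : i + p ≤ n) :
    Matrix (Fin p → Fin N) (Fin p → Fin N) α →ₐ[ℂ] Matrix (Fin n → Fin N) (Fin n → Fin N) α :=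
  AlgHom.ofLinearMap
    { toFun := embed α N h
      map_add' := fun X Y => by
        ext a b
        simp only [embed_apply, Matrix.add_apply]
        split_ifs <;> simp
      map_smul' := fun c X => by
        ext a b
        simp [embed_apply] }
    (by simpa using embed_diagonal h (1 : α)) (embed_mul h)

theorem embed_matAt (h : i + p ≤ n) {j : ℕ} (hj : j < p) (X : Matrix (Fin N) (Fin N) α) :
    embed α N h (matAt N p X j) = matAt N n X (i + j) := by
  ext a b
  rw [embed_apply, matAt_apply hj, matAt_apply (by omega), ← ite_and]
  refine if_congr ⟨fun h2 l hl => ?_, fun h2 => ⟨fun l hl => h2 l (by omega), fun l hl =>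
    h2 _ (by simpa [place] using hl)⟩⟩ rfl rfl
  by_cases hl' : i ≤ l ∧ (l : ℕ) < i + p
  · have := h2.2 ⟨l - i, by omega⟩ (by simp only; omega)
    simp only [Function.comp_apply, place] at this
    rwa [show (⟨i + ((l : ℕ) - i), by omega⟩ : Fin n) = l from
      Fin.ext (Nat.add_sub_cancel' hl'.1)] at this
  · exact h2.1 l (by omega)

theorem embed_opAt (h : i + p ≤ n) {j : ℕ} (hj : j + 1 < p)
    (X : Matrix (Fin N × Fin N) (Fin N × Fin N) α) :
    embed α N h (opAt N p X j) = opAt N n X (i + j) := by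
  ext a b
  rw [embed_apply, opAt_apply hj, opAt_apply (by omega), ← ite_and]
  refine if_congr ⟨fun h2 l hl hl1 => ?_, fun h2 => ⟨fun l hl => h2 l (by omega) (by omega),
    fun l hl hl1 => h2 _ (by simpa [place] using hl)
      (by simp only [place]; omega)⟩⟩ rfl rfl
  by_cases hl' : i ≤ l ∧ (l : ℕ) < i + p
  · have := h2.2 ⟨l - i, by omega⟩ (by simp only; omega) (by simp only; omega)
    simp only [Function.comp_apply, place] at this
    rwa [show (⟨i + ((l : ℕ) - i), by omega⟩ : Fin n) = l from
      Fin.ext (Nat.add_sub_cancel' hl'.1)] at this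
  · exact h2.1 l (by omega)

variable [Algebra ℂ α]

theorem embedHom_apply (h : i + p ≤ n) (X : Matrix (Fin p → Fin N) (Fin p → Fin N) α) :
    embedHom α N h X = embed α N h X := rfl

theorem iterTr_map {B B' : Type*} [Ring B] [Algebra ℂ B] [Ring B'] [Algebra ℂ B']
    (φ : B →ₐ[ℂ] B') {C : Matrix (Fin N) (Fin N) ℂ} {e : ℕ → Fin N → Fin N → B}
    {e' : ℕ → Fin N → Fin N → B'} {l : ℕ} (h : ∀ j, j < l → ∀ a b, φ (e j a b) = e' j a b) (x : B) :
    iterTr C e' 0 l (φ x) = φ (iterTr C e 0 l x) := by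
  induction l generalizing x with
  | zero => rfl
  | succ l ih =>
    rw [iterTr, iterTr, ← ih (fun j hj => h j (by omega))]
    congr 1
    simp only [siteTr, map_sum, map_smul, map_mul, zero_add, h l (by omega)]

end Embedding

section MatrixTower

variable {A : Type*} [Ring A] [Algebra ℂ A] {N n : ℕ} {q : ℂ}
  {R Rinv Ψ : Matrix (Fin N × Fin N) (Fin N × Fin N) ℂ}

theorem map_opAt {α β : Type*} [Ring α] [Ring β] (f : α →+* β)
    (S : Matrix (Fin N × Fin N) (Fin N × Fin N) α) (i : ℕ) :
    f.mapMatrix (opAt N n S i) = opAt N n (S.map f) i := by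
  by_cases hi : i + 1 < n
  · ext a b
    rw [opAt_apply hi, RingHom.mapMatrix_apply, Matrix.map_apply, opAt_apply hi]
    split_ifs <;> simp
  · rw [opAt, opAt, dif_neg hi, dif_neg hi, map_one]

theorem opAt_braid (hbraid : IsBraid N R) {i : ℕ} (hi : i + 2 < n) :
    opAt N n (toA A R) i * opAt N n (toA A R) (i + 1) * opAt N n (toA A R) i =
      opAt N n (toA A R) (i + 1) * opAt N n (toA A R) i * opAt N n (toA A R) (i + 1) := by
  have h := congrArg (algebraMap ℂ A).mapMatrix hbraid
  simp only [map_mul, map_opAt, show R.map (algebraMap ℂ A) = toA A R from rfl] at h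
  have h' := congrArg (embedHom A N (show i + 3 ≤ n from hi)) h
  simpa only [map_mul, embedHom_apply, embed_opAt (show i + 3 ≤ n from hi) (show 0 + 1 < 3 by simp),
    embed_opAt (show i + 3 ≤ n from hi) (show 1 + 1 < 3 by simp), add_zero] using h'

theorem traceMat_kronecker_comm_of_isBraid (hN : 1 ≤ N) (hRinv : R * Rinv = 1 ∧ Rinv * R = 1)
    (hbraid : IsBraid N R) (hΨ : SkewInv N R Ψ) :
    (∀ a b, ptrace (traceMat N Ψ) (R * unitFst a b * Rinv) = traceMat N Ψ b a • 1) ∧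
      Matrix.kroneckerMap (· * ·) (traceMat N Ψ) (traceMat N Ψ) * R =
        R * Matrix.kroneckerMap (· * ·) (traceMat N Ψ) (traceMat N Ψ) := by
  have : Nonempty (Fin N) := ⟨⟨0, hN⟩⟩
  set e := siteUnit ℂ N 3
  have he : ∀ i, i < 3 → MatUnits (e i) := fun i hi => matUnits_siteUnit hi
  have hc : ∀ i j, i < 3 → j < 3 → i ≠ j → ∀ a b c d, e i a b * e j c d = e j c d * e i a b :=
    fun i j hi hj hij => siteUnit_comm hi hj hij
  have h01 := (he 0 (by simp)).prod (he 1 (by simp)) (hc 0 1 (by simp) (by simp) (by simp))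
  have h12 := (he 1 (by simp)).prod (he 2 (by simp)) (hc 1 2 (by simp) (by simp) (by simp))
  set r₀ := matRep (prodUnits (e 0) (e 1)) R with hr₀
  set r₁ := matRep (prodUnits (e 1) (e 2)) R with hr₁
  set s₀ := matRep (prodUnits (e 0) (e 1)) Rinv with hs₀
  set s₁ := matRep (prodUnits (e 1) (e 2)) Rinv with hs₁
  have hbr : r₀ * r₁ * r₀ = r₁ * r₀ * r₁ := by
    have := opAt_braid (A := ℂ) hbraid (show 0 + 2 < 3 by simp)
    rwa [← matRep_prodUnits_siteUnit (by simp), ← matRep_prodUnits_siteUnit (by simp)] at this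
  have rs₀ : r₀ * s₀ = 1 := by rw [← h01.matRep_mul, hRinv.1, h01.matRep_one]
  have sr₀ : s₀ * r₀ = 1 := by rw [← h01.matRep_mul, hRinv.2, h01.matRep_one]
  have rs₁ : r₁ * s₁ = 1 := by rw [← h12.matRep_mul, hRinv.1, h12.matRep_one]
  have sr₁ : s₁ * r₁ = 1 := by rw [← h12.matRep_mul, hRinv.2, h12.matRep_one]
  have htr : siteTr (traceMat N Ψ) (e 2) r₁ = 1 := by
    rw [siteTr_matRep (he 2 (by simp)) (hc 1 2 (by simp) (by simp) (by simp)),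
      ptrace_traceMat hΨ, (he 1 (by simp)).matRep_one]
  have hr₀2 : ∀ S a b, e 2 a b * matRep (prodUnits (e 0) (e 1)) S =
      matRep (prodUnits (e 0) (e 1)) S * e 2 a b := fun S a b =>
    (matRep_prodUnits_comm (fun c d => hc 0 2 (by simp) (by simp) (by simp) _ _ _ _)
      (fun c d => hc 1 2 (by simp) (by simp) (by simp) _ _ _ _) S).symm
  have htr' : ∀ x y, (∀ a b, e 2 a b * x = x * e 2 a b) → (∀ a b, e 2 a b * y = y * e 2 a b) →
      x * y = 1 → siteTr (traceMat N Ψ) (e 2) (x * r₁ * y) = 1 := fun x y hx hy hxy => by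
    rw [siteTr_mul_right _ hy, siteTr_mul_left _ hx, htr, mul_one, hxy]
  have h1 := ptrace_conj_of_siteTr hΨ (he 0 (by simp)) (he 1 (by simp)) (he 2 (by simp))
    (hc 0 1 (by simp) (by simp) (by simp)) (hc 0 2 (by simp) (by simp) (by simp))
    (hc 1 2 (by simp) (by simp) (by simp)) (X := R) (Y := Rinv) (by
      rw [← hr₀, ← hr₁, ← hs₁]
      have : r₁ * r₀ * s₁ = s₀ * r₁ * r₀ := by
        calc r₁ * r₀ * s₁ = s₀ * (r₀ * r₁ * r₀) * s₁ := by
              rw [mul_assoc r₀, ← mul_assoc s₀, sr₀, one_mul]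
          _ = s₀ * r₁ * r₀ := by
              rw [hbr, mul_assoc _ _ s₁, mul_assoc _ _ s₁, rs₁, mul_one, mul_assoc]
      rw [this]
      exact htr' _ _ (hr₀2 _) (hr₀2 _) sr₀)
  have h2 := ptrace_conj_of_siteTr hΨ (he 0 (by simp)) (he 1 (by simp)) (he 2 (by simp))
    (hc 0 1 (by simp) (by simp) (by simp)) (hc 0 2 (by simp) (by simp) (by simp))
    (hc 1 2 (by simp) (by simp) (by simp)) (X := Rinv) (Y := R) (by
      rw [← hr₀, ← hr₁, ← hs₁]
      have : s₁ * r₀ * r₁ = r₀ * r₁ * s₀ := by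
        calc s₁ * r₀ * r₁ = s₁ * (r₀ * r₁ * r₀) * s₀ := by
              simp only [mul_assoc, rs₀, mul_one]
          _ = r₀ * r₁ * s₀ := by rw [hbr]; simp only [← mul_assoc, sr₁, one_mul]
      rw [this]
      exact htr' _ _ (hr₀2 _) (hr₀2 _) rs₀)
  have hS := traceMat_kronecker_comm hΨ h1 h2
  refine ⟨h1, ?_⟩
  set K := Matrix.kroneckerMap (· * ·) (traceMat N Ψ) (traceMat N Ψ)
  calc K * R = R * (Rinv * K) * R := by rw [← mul_assoc, hRinv.1, one_mul]
    _ = R * K := by rw [← hS, mul_assoc, mul_assoc, hRinv.2, mul_one]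

theorem sq_eq_of_isHecke (hq : q ≠ 0) (hHecke : IsHecke N q R) : R * R = (q - q⁻¹) • R + 1 := by
  rw [IsHecke] at hHecke
  rw [sub_mul, smul_mul_assoc, one_mul, mul_add, smul_add, smul_smul, mul_inv_cancel₀ hq, one_smul,
    mul_smul_comm, mul_one] at hHecke
  rw [sub_smul, ← sub_eq_zero, ← neg_eq_zero, ← hHecke]
  abel

theorem braidTower_opAt (hN : 1 ≤ N) (hq : q ≠ 0) (hRinv : R * Rinv = 1 ∧ Rinv * R = 1)
    (hbraid : IsBraid N R) (hHecke : IsHecke N q R) (hΨ : SkewInv N R Ψ) :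
    BraidTower n q (traceMat N Ψ) (siteUnit A N n) (opAt N n (toA A R))
      (opAt N n (toA A Rinv)) := by
  have hu : ∀ i, i < n → MatUnits (siteUnit A N n i) := fun i hi => matUnits_siteUnit hi
  have hcomm : ∀ i, i + 1 < n → ∀ a b c d, siteUnit A N n i a b * siteUnit A N n (i + 1) c d =
      siteUnit A N n (i + 1) c d * siteUnit A N n i a b := fun i hi =>
    siteUnit_comm (by omega) hi (by omega)
  have hprod : ∀ i, i + 1 < n → MatUnits (prodUnits (siteUnit A N n i) (siteUnit A N n (i + 1))) :=
    fun i hi => (hu i (by omega)).prod (hu _ hi) (hcomm i hi)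
  obtain ⟨hconj, hK⟩ := traceMat_kronecker_comm_of_isBraid hN hRinv hbraid hΨ
  refine ⟨hu, fun i j hi hj hij => siteUnit_comm hi hj hij, opAt_mul_opAt hRinv.1,
    opAt_mul_opAt hRinv.2, fun i hi y h1 h2 => ?_, fun i hi => ?_, fun i hi => opAt_braid hbraid hi,
    fun i hi => ?_, fun i hi a b => ?_, fun i hi y => ?_⟩
  · rw [← matRep_prodUnits_siteUnit hi]
    exact matRep_prodUnits_comm h1 h2 R
  · rw [← matRep_prodUnits_siteUnit hi, ← (hprod i hi).matRep_mul, sq_eq_of_isHecke hq hHecke,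
      matRep_add, matRep_smul, (hprod i hi).matRep_one]
  · rw [← matRep_prodUnits_siteUnit hi, siteTr_matRep (hu _ hi) (hcomm i hi), ptrace_traceMat hΨ,
      (hu i (by omega)).matRep_one]
  · rw [← matRep_prodUnits_siteUnit hi, ← matRep_prodUnits_siteUnit hi,
      siteTr_conj_unit (hu i (by omega)) (hu _ hi) (hcomm i hi), hconj, matRep_smul,
      (hu i (by omega)).matRep_one]
  · rw [siteTr_siteTr (hcomm i hi), siteTr_siteTr (hcomm i hi), ← matRep_prodUnits_siteUnit hi]
    exact (hprod i hi).siteTr_comm hK y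

end MatrixTower

section MatrixTrace

variable {A : Type*} [Ring A] {N n : ℕ}

theorem trace_siteUnit_mul {i : ℕ} (hi : i < n) (a b : Fin N)
    (X : Matrix (Fin n → Fin N) (Fin n → Fin N) A) :
    Matrix.trace (siteUnit A N n i a b * X) = Matrix.trace (X * siteUnit A N n i a b) := by
  simp only [Matrix.trace, Matrix.diag, Matrix.mul_apply]
  rw [Finset.sum_comm]
  refine Finset.sum_congr rfl fun c _ => Finset.sum_congr rfl fun d _ => ?_
  rw [siteUnit, matAt_apply hi, Matrix.single_apply]
  split_ifs <;> simp

theorem eq_diagonal_of_commute (hN : 1 ≤ N) {X : Matrix (Fin n → Fin N) (Fin n → Fin N) A}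
    (hX : ∀ j, j < n → ∀ a b, siteUnit A N n j a b * X = X * siteUnit A N n j a b) :
    ∃ c, X = Matrix.diagonal fun _ => c := by
  have key : ∀ (j : Fin n) (w : Fin N) (a b : Fin n → Fin N),
      X (Function.update a j w) b = if b j = w then X a (Function.update b j (a j)) else 0 := by
    intro j w a b
    have := congrFun (congrFun (hX j j.2 (a j) w) a) b
    rw [siteUnit, matAt_mul_apply j.2, mul_matAt_apply j.2] at this
    simpa [Matrix.single_apply, ite_and, eq_comm (a := w), eq_comm (b := a j)] using this
  have hoff : ∀ a b, a ≠ b → X a b = 0 := by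
    intro a b hab
    obtain ⟨j, hj⟩ := Function.ne_iff.1 hab
    have := key j (a j) a b
    rwa [Function.update_eq_self, if_neg hj.symm] at this
  have hdiag : ∀ a b (S : Finset (Fin n)), X (S.piecewise b a) (S.piecewise b a) = X a a := by
    intro a b S
    induction S using Finset.induction_on with
    | empty => simp
    | insert j S _ ih =>
      rw [Finset.piecewise_insert, key, Function.update_self, if_pos rfl,
        Function.update_idem, Function.update_eq_self, ih]
  refine ⟨X (fun _ => ⟨0, hN⟩) (fun _ => ⟨0, hN⟩), ?_⟩
  ext a b
  rw [Matrix.diagonal_apply]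
  split_ifs with h
  · subst h
    simpa using hdiag (fun _ => ⟨0, hN⟩) a Finset.univ
  · exact hoff a b h

variable [Algebra ℂ A]

theorem iterTr_eq_diagonal (hN : 1 ≤ N) (C : Matrix (Fin N) (Fin N) ℂ)
    (X : Matrix (Fin n → Fin N) (Fin n → Fin N) A)
    (hX : ∀ j, j < n → iterTr C (siteUnit A N n) 0 n X ∈ site (siteUnit A N n) j) :
    iterTr C (siteUnit A N n) 0 n X = Matrix.diagonal fun _ => qTr N n (toA A C) X := by
  set P : ℕ → Matrix (Fin n → Fin N) (Fin n → Fin N) A := fun j =>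
    ((List.range j).map (matAt N n (toA A C))).prod with hP
  have hPs : ∀ j, P (j + 1) = P j * matAt N n (toA A C) j := fun j => by
    simp [hP, List.range_succ]
  have hPc : ∀ i j, j ≤ i → i < n → ∀ a b,
      siteUnit A N n i a b * P j = P j * siteUnit A N n i a b := by
    intro i j hj hi a b
    induction j with
    | zero => simp [hP]
    | succ j ih =>
      rw [hPs, ← mul_assoc, ih (by omega), mul_assoc,
        siteUnit_mul_matAt hi (by omega) (by omega), mul_assoc]
  have hstep : ∀ j, j < n → ∀ x, Matrix.trace (P j * siteTr C (siteUnit A N n j) x) =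
      (N : ℂ) • Matrix.trace (P (j + 1) * x) := by
    intro j hj x
    have h1 : ∀ a b w, Matrix.trace (P j * (siteUnit A N n j w b * x * siteUnit A N n j a w)) =
        Matrix.trace (P j * (siteUnit A N n j a b * x)) := by
      intro a b w
      rw [← mul_assoc, ← trace_siteUnit_mul hj, ← mul_assoc, hPc j j le_rfl hj, ← mul_assoc,
        mul_assoc (P j), (matUnits_siteUnit hj).mul, if_pos rfl, mul_assoc]
    simp only [siteTr, Finset.mul_sum, Matrix.trace_sum, mul_smul_comm, Matrix.trace_smul, h1]
    rw [hPs, ← matRep_siteUnit hj, matRep]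
    simp [Finset.mul_sum, Finset.sum_mul, Matrix.trace_sum, Matrix.trace_smul, mul_assoc,
      Finset.smul_sum, Nat.cast_smul_eq_nsmul]
  have hall : ∀ l, l ≤ n → ∀ x, Matrix.trace (iterTr C (siteUnit A N n) 0 l x) =
      ((N : ℂ) ^ l) • Matrix.trace (P l * x) := by
    intro l hl
    induction l with
    | zero => intro x; simp [iterTr, hP]
    | succ l ih =>
      intro x
      rw [iterTr, ih (by omega), zero_add, hstep l hl, smul_smul, pow_succ]
  obtain ⟨c, hc⟩ := eq_diagonal_of_commute hN fun j hj => mem_site.1 (hX j hj)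
  rw [hc]
  have hfin := hall n le_rfl X
  rw [hc, Matrix.trace_diagonal] at hfin
  have hN' : ((N : ℂ) ^ n) ≠ 0 := pow_ne_zero _ (Nat.cast_ne_zero.2 (by omega))
  have : ((N : ℂ) ^ n) • c = ((N : ℂ) ^ n) • qTr N n (toA A C) X := by
    rw [qTr, ← hfin]
    simp [← Nat.cast_smul_eq_nsmul ℂ]
  rw [smul_right_injective A hN' this]

end MatrixTrace

section Transfer

variable {A : Type*} [Ring A] [Algebra ℂ A] {N n p : ℕ} {q : ℂ}
  {R Rinv : Matrix (Fin N × Fin N) (Fin N × Fin N) ℂ} {M D : Matrix (Fin N) (Fin N) A}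

theorem matAt_zero_mem_site (X : Matrix (Fin N) (Fin N) A) (j : ℕ) (h1 : 1 ≤ j) (hj : j < n) :
    matAt N n X 0 ∈ site (siteUnit A N n) j :=
  mem_site.2 fun a b => siteUnit_mul_matAt hj (by omega) (by omega) a b X

theorem embedHom_opAt (h : 0 + p ≤ n) {j : ℕ} (hj : j + 1 < p)
    (X : Matrix (Fin N × Fin N) (Fin N × Fin N) A) :
    embedHom A N h (opAt N p X j) = opAt N n X j := by
  rw [embedHom_apply, embed_opAt h hj, zero_add]

theorem embedHom_matAt (h : 0 + p ≤ n) {j : ℕ} (hj : j < p) (X : Matrix (Fin N) (Fin N) A) :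
    embedHom A N h (matAt N p X j) = matAt N n X j := by
  rw [embedHom_apply, embed_matAt h hj, zero_add]

theorem PermRel.matAt_opAt (h : PermRel N R Rinv M D) {m k : ℕ} (hk : 1 ≤ k) (hm : 1 ≤ m) :
    matAt N (m + k) D 0 * opAt N (m + k) (toA A R) 0 * matAt N (m + k) M 0 *
        opAt N (m + k) (toA A R) 0 =
      opAt N (m + k) (toA A R) 0 * matAt N (m + k) M 0 * opAt N (m + k) (toA A Rinv) 0 *
        matAt N (m + k) D 0 + opAt N (m + k) (toA A R) 0 := by
  have h' := congrArg (embedHom A N (show 0 + 2 ≤ m + k by omega)) h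
  simpa only [map_mul, map_add, embedHom_opAt _ (show 0 + 1 < 2 by simp),
    embedHom_matAt _ (show 0 < 2 by simp)] using h'

theorem embedHom_ovProd (h : 0 + p ≤ n) (R Rinv : Matrix (Fin N × Fin N) (Fin N × Fin N) A)
    (X : Matrix (Fin N) (Fin N) A) :
    embedHom A N h (ovProd N p R Rinv X p) =
      copyProd (opAt N n R) (opAt N n Rinv) (matAt N n X 0) 0 p := by
  have hcopy : ∀ t, t < p → embedHom A N h (ovCopy N p R Rinv X t) =
      conjCopy (opAt N n R) (opAt N n Rinv) (matAt N n X 0) t := by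
    intro t ht
    induction t with
    | zero => exact embedHom_matAt h ht X
    | succ t ih =>
      rw [ovCopy, conjCopy, map_mul, map_mul, embedHom_opAt h ht, embedHom_opAt h ht,
        ih (by omega)]
  have hprod : ∀ l, l ≤ p → embedHom A N h (ovProd N p R Rinv X l) =
      copyProd (opAt N n R) (opAt N n Rinv) (matAt N n X 0) 0 l := by
    intro l hl
    induction l with
    | zero => simp [ovProd, copyProd]
    | succ l ih =>
      have : ovProd N p R Rinv X (l + 1) = ovProd N p R Rinv X l * ovCopy N p R Rinv X l := by
        simp [ovProd, List.range_succ]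
      rw [this, map_mul, ih (by omega), hcopy l hl, copyProd, zero_add]
  exact hprod p le_rfl

theorem mem_seg_of_mem_adjoin (h : 0 + p ≤ n)
    {S : Matrix (Fin N × Fin N) (Fin N × Fin N) A} {Z : Matrix (Fin p → Fin N) (Fin p → Fin N) A}
    (hZ : Z ∈ Algebra.adjoin ℂ (genSet N p p S)) : embedHom A N h Z ∈ seg (opAt N n S) 0 p := by
  have hle : Algebra.adjoin ℂ (genSet N p p S) ≤ (seg (opAt N n S) 0 p).comap (embedHom A N h) := by
    refine Algebra.adjoin_le ?_
    rintro _ ⟨i, hi, rfl⟩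
    rw [SetLike.mem_coe, Subalgebra.mem_comap, embedHom_opAt h hi]
    exact r_mem_seg (Nat.zero_le _) hi
  exact hle hZ

theorem exists_mem_adjoin_of_mem_seg (h : 0 + p ≤ n)
    {S : Matrix (Fin N × Fin N) (Fin N × Fin N) A} {z : Matrix (Fin n → Fin N) (Fin n → Fin N) A}
    (hz : z ∈ seg (opAt N n S) 0 p) :
    ∃ Z ∈ Algebra.adjoin ℂ (genSet N p p S), embedHom A N h Z = z := by
  have hle : seg (opAt N n S) 0 p ≤ (Algebra.adjoin ℂ (genSet N p p S)).map (embedHom A N h) := by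
    refine Algebra.adjoin_le ?_
    rintro _ ⟨i, -, hi, rfl⟩
    exact ⟨_, Algebra.subset_adjoin ⟨i, hi, rfl⟩, embedHom_opAt h hi S⟩
  exact hle hz

theorem iterTr_embedHom (hN : 1 ≤ N) (h : 0 + p ≤ n) {C : Matrix (Fin N) (Fin N) ℂ}
    {r s : ℕ → Matrix (Fin p → Fin N) (Fin p → Fin N) A}
    (T : BraidTower p q C (siteUnit A N p) r s)
    (X : Matrix (Fin p → Fin N) (Fin p → Fin N) A) :
    iterTr C (siteUnit A N n) 0 p (embedHom A N h X) =
      Matrix.diagonal fun _ => qTr N p (toA A C) X := by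
  rw [iterTr_map (embedHom A N h) (e := siteUnit A N p) (e' := siteUnit A N n)
      fun j hj a b => embedHom_matAt h hj _,
    iterTr_eq_diagonal hN C X fun j hj =>
      T.iterTr_mem_site (by omega) hj (Or.inl ⟨Nat.zero_le _, by omega⟩)]
  exact embed_diagonal h _

/-- The matrices all of whose entries lie in the left ideal generated by the entries of `D`. -/
def entries (n : ℕ) (D : Matrix (Fin N) (Fin N) A) :
    Submodule ℂ (Matrix (Fin n → Fin N) (Fin n → Fin N) A) where
  carrier := {x | ∀ a b, x a b ∈ entryIdeal A D}
  add_mem' hx hy a b := Submodule.add_mem _ (hx a b) (hy a b)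
  zero_mem' _ _ := Submodule.zero_mem _
  smul_mem' c x hx a b := by
    rw [Matrix.smul_apply, Algebra.smul_def]
    exact Submodule.smul_mem _ _ (hx a b)

theorem mem_entries {x : Matrix (Fin n → Fin N) (Fin n → Fin N) A} :
    x ∈ entries n D ↔ ∀ a b, x a b ∈ entryIdeal A D := Iff.rfl

theorem mul_mem_entries_of_numeric {x y : Matrix (Fin n → Fin N) (Fin n → Fin N) A}
    (hx : x ∈ entries n D) (hy : ∀ a b, ∃ c : ℂ, y a b = algebraMap ℂ A c) :
    x * y ∈ entries n D := by
  refine mem_entries.2 fun a b => ?_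
  rw [Matrix.mul_apply]
  refine Submodule.sum_mem _ fun d _ => ?_
  obtain ⟨c, hc⟩ := hy d b
  rw [hc, ← Algebra.commutes]
  exact Submodule.smul_mem _ _ (hx a d)

theorem stableIdeal_entries (R : Matrix (Fin N × Fin N) (Fin N × Fin N) ℂ)
    (D : Matrix (Fin N) (Fin N) A) :
    StableIdeal n (siteUnit A N n) (opAt N n (toA A R)) (entries n D) where
  mul_mem x y hy := mem_entries.2 fun a b => by
    rw [Matrix.mul_apply]
    exact Submodule.sum_mem _ fun d _ => Submodule.smul_mem _ _ (hy d b)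
  mul_unit y hy i hi a b := mul_mem_entries_of_numeric hy fun c d => by
    rw [siteUnit, matAt_apply hi, Matrix.single_apply]
    split_ifs
    exacts [⟨1, (map_one _).symm⟩, ⟨0, (map_zero _).symm⟩, ⟨0, (map_zero _).symm⟩]
  mul_r y hy i hi := mul_mem_entries_of_numeric hy fun c d => by
    rw [opAt_apply hi]
    split_ifs
    exacts [⟨_, rfl⟩, ⟨0, (map_zero _).symm⟩]

theorem matAt_mem_entries (hn : 0 < n) (D : Matrix (Fin N) (Fin N) A) :
    matAt N n D 0 ∈ entries n D := mem_entries.2 fun a b => by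
  rw [matAt_apply hn]
  split_ifs
  · exact Submodule.subset_span ⟨_, _, rfl⟩
  · exact Submodule.zero_mem _

theorem diagonal_mem_entries (hN : 1 ≤ N) {c : A}
    (h : (Matrix.diagonal fun _ => c) ∈ entries n D) : c ∈ entryIdeal A D := by
  simpa using h (fun _ => ⟨0, hN⟩) (fun _ => ⟨0, hN⟩)

end Transfer

/-- Every generalized quantum Laplace operator maps the characteristic
subalgebra into itself: for `k ≥ m`, the product
`Tr_{R(1…m)}(Q·D_{⟨1→m⟩}) · Tr_{R(1…k)}(Z·M_{⟨1→k⟩})` equals some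
`Tr_{R(1…(k−m))}(Z̃·M_{⟨1→(k−m)⟩})` modulo the left ideal generated by the entries of
`D`; for `k < m` the product itself lies in that ideal. -/
theorem stmt8 {A : Type*} [Ring A] [Algebra ℂ A] (N : ℕ) (hN : 1 ≤ N) (q : ℂ)
    (hq : GenericQ q)
    (R Rinv Ψ : Matrix (Fin N × Fin N) (Fin N × Fin N) ℂ)
    (hRinv : R * Rinv = 1 ∧ Rinv * R = 1)
    (hbraid : IsBraid N R) (hHecke : IsHecke N q R)
    (hΨ : SkewInv N R Ψ)
    (M D : Matrix (Fin N) (Fin N) A)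
    (hM : RErel N (toA A R) M)
    (hD : RErel N (toA A Rinv) D)
    (hDM : PermRel N R Rinv M D)
    (m k : ℕ) (hm : 1 ≤ m) (hk : 1 ≤ k)
    (Q : Matrix (Fin m → Fin N) (Fin m → Fin N) A)
    (hQ : Q ∈ Algebra.adjoin ℂ (genSet N m m (toA A R)))
    (Z : Matrix (Fin k → Fin N) (Fin k → Fin N) A)
    (hZ : Z ∈ Algebra.adjoin ℂ (genSet N k k (toA A R))) :
    (m ≤ k →
      ∃ Zt : Matrix (Fin (k - m) → Fin N) (Fin (k - m) → Fin N) A,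
        Zt ∈ Algebra.adjoin ℂ (genSet N (k - m) (k - m) (toA A R)) ∧
        (qTr N m (toA A (traceMat N Ψ)) (Q * ovProd N m (toA A R) (toA A Rinv) D m) *
            qTr N k (toA A (traceMat N Ψ)) (Z * ovProd N k (toA A R) (toA A Rinv) M k) -
          qTr N (k - m) (toA A (traceMat N Ψ))
            (Zt * ovProd N (k - m) (toA A R) (toA A Rinv) M (k - m))) ∈
          entryIdeal A D) ∧
    (k < m →
      qTr N m (toA A (traceMat N Ψ)) (Q * ovProd N m (toA A R) (toA A Rinv) D m) *
          qTr N k (toA A (traceMat N Ψ)) (Z * ovProd N k (toA A R) (toA A Rinv) M k) ∈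
        entryIdeal A D) := by
  have hn : 0 + m ≤ m + k := by omega
  have hn' : 0 + k ≤ m + k := by omega
  have hq0 := hq.1
  have T : BraidTower (m + k) q (traceMat N Ψ) (siteUnit A N (m + k)) (opAt N (m + k) (toA A R))
    (opAt N (m + k) (toA A Rinv)) := braidTower_opAt hN hq0 hRinv hbraid hHecke hΨ
  have hsite := fun X : Matrix (Fin N) (Fin N) A => matAt_zero_mem_site (n := m + k) X
  have hJ := stableIdeal_entries (n := m + k) R D
  have hDJ := matAt_mem_entries (n := m + k) (by omega) D
  have hZ' := mem_seg_of_mem_adjoin hn' hZ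
  have hQ' := mem_seg_of_mem_adjoin hn hQ
  have hprod : iterTr (traceMat N Ψ) (siteUnit A N (m + k)) 0 m (embedHom A N hn Q *
      copyProd (opAt N (m + k) (toA A R)) (opAt N (m + k) (toA A Rinv)) (matAt N (m + k) D 0) 0 m) *
      iterTr (traceMat N Ψ) (siteUnit A N (m + k)) 0 k (embedHom A N hn' Z *
      copyProd (opAt N (m + k) (toA A R)) (opAt N (m + k) (toA A Rinv)) (matAt N (m + k) M 0) 0 k) =
      Matrix.diagonal fun _ =>
        qTr N m (toA A (traceMat N Ψ)) (Q * ovProd N m (toA A R) (toA A Rinv) D m) *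
          qTr N k (toA A (traceMat N Ψ)) (Z * ovProd N k (toA A R) (toA A Rinv) M k) := by
    rw [← embedHom_ovProd hn, ← embedHom_ovProd hn', ← map_mul, ← map_mul,
      iterTr_embedHom hN hn (braidTower_opAt hN hq0 hRinv hbraid hHecke hΨ),
      iterTr_embedHom hN hn' (braidTower_opAt hN hq0 hRinv hbraid hHecke hΨ),
      Matrix.diagonal_mul_diagonal]
  refine ⟨fun hmk => ?_, fun hkm => ?_⟩
  · obtain ⟨v, hv, h⟩ := T.exists_iterTr_mul_sub_mem (hsite M) (hsite D)
      (fun _ => hDM.matAt_opAt hk hm) hJ hDJ rfl hQ' hZ' hmk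
    have hn'' : 0 + (k - m) ≤ m + k := by omega
    obtain ⟨Zt, hZt, rfl⟩ := exists_mem_adjoin_of_mem_seg hn'' hv
    refine ⟨Zt, hZt, ?_⟩
    rw [hprod, ← embedHom_ovProd hn'', ← map_mul, iterTr_embedHom hN hn''
      (braidTower_opAt hN hq0 hRinv hbraid hHecke hΨ), Matrix.diagonal_sub] at h
    exact diagonal_mem_entries hN h
  · have h := T.iterTr_mul_mem (hsite M) (hsite D) (fun _ => hDM.matAt_opAt hk hm) hJ hDJ rfl
      hQ' hZ' hkm
    rw [hprod] at h
    exact diagonal_mem_entries hN h
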